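/- arXiv:1901.00265 — 4 statements merged into one kernel-verified Lean document; each statement's English description precedes it below -/
import Mathlib

section
/- Assume d ≥ 2, let A be a P-module in ℝ^d, let K be a separable Hilbert space, and let V = {V_x}_{x∈P} be the isometric representation of P on L²(A; K) given by (V_x f)(y) = f(y − x) if y − x ∈ A and 0 otherwise. For z ∈ G_A let U_z be the unitary on L²(A; K) given by (U_z f)(y) = f(y − z), and for S ∈ B(K) let M_S be the bounded operator on L²(A; K) given by (M_S f)(y) = S(f(y)). Then the commutant of {V_x : x ∈ P} ∪ {V_x* : x ∈ P} in B(L²(A; K)) equals the double commutant ({U_z : z ∈ G_A} ∪ {M_S : S ∈ B(K)})′′. -/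
noncomputable section

open MeasureTheory Filter Topology
open scoped ENNReal

section Multiplication

variable {X : Type*} [MeasurableSpace X] {μ : Measure X}

/-- Multiplication by a bounded measurable function, as an operator on `L²`. -/
def mulLp (μ : Measure X) (h : X → ℂ) (hm : Measurable h) (hb : ∃ C, ∀ x, ‖h x‖ ≤ C) :
    Lp ℂ 2 μ →L[ℂ] Lp ℂ 2 μ :=
  (ContinuousLinearMap.mul ℂ ℂ).holderL μ ∞ 2 2
    ((memLp_top_of_bound hm.aestronglyMeasurable hb.choose
      (Eventually.of_forall hb.choose_spec)).toLp h)

theorem coeFn_mulLp {h : X → ℂ} (hm : Measurable h) (hb : ∃ C, ∀ x, ‖h x‖ ≤ C)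
    (f : Lp ℂ 2 μ) : mulLp μ h hm hb f =ᵐ[μ] fun x => h x * f x := by
  have h1 := (ContinuousLinearMap.mul ℂ ℂ).coeFn_holder (r := 2)
    ((memLp_top_of_bound (μ := μ) hm.aestronglyMeasurable hb.choose
      (Eventually.of_forall hb.choose_spec)).toLp h) f
  have h2 := (memLp_top_of_bound (μ := μ) hm.aestronglyMeasurable hb.choose
      (Eventually.of_forall hb.choose_spec)).coeFn_toLp
  filter_upwards [h1, h2] with x h1 h2
  rw [← h2]
  exact h1

/-- `h` is a bounded measurable function and `S` commutes with multiplication by `h`. -/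
structure CommutesMul (S : Lp ℂ 2 μ →L[ℂ] Lp ℂ 2 μ) (h : X → ℂ) : Prop where
  measurable : Measurable h
  bounded : ∃ C, ∀ x, ‖h x‖ ≤ C
  comm : ∀ f g : Lp ℂ 2 μ, g =ᵐ[μ] (fun x => h x * f x) → S g =ᵐ[μ] fun x => h x * S f x

namespace CommutesMul

variable {S : Lp ℂ 2 μ →L[ℂ] Lp ℂ 2 μ} {h h₁ h₂ : X → ℂ}

theorem const (c : ℂ) : CommutesMul S (fun _ => c) where
  measurable := measurable_const
  bounded := ⟨‖c‖, fun _ => le_rfl⟩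
  comm f g hg := by
    have : g = c • f := Lp.ext (hg.trans (Lp.coeFn_smul c f).symm)
    rw [this, map_smul]
    exact Lp.coeFn_smul c (S f)

theorem add (H₁ : CommutesMul S h₁) (H₂ : CommutesMul S h₂) :
    CommutesMul S (fun x => h₁ x + h₂ x) where
  measurable := H₁.measurable.add H₂.measurable
  bounded := by
    obtain ⟨C₁, hC₁⟩ := H₁.bounded
    obtain ⟨C₂, hC₂⟩ := H₂.bounded
    exact ⟨C₁ + C₂, fun x => (norm_add_le _ _).trans (add_le_add (hC₁ x) (hC₂ x))⟩
  comm f g hg := by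
    have e₁ := coeFn_mulLp (μ := μ) H₁.measurable H₁.bounded f
    have e₂ := coeFn_mulLp (μ := μ) H₂.measurable H₂.bounded f
    have : g = mulLp μ h₁ H₁.measurable H₁.bounded f + mulLp μ h₂ H₂.measurable H₂.bounded f := by
      apply Lp.ext
      filter_upwards [hg, e₁, e₂, Lp.coeFn_add (mulLp μ h₁ H₁.measurable H₁.bounded f)
        (mulLp μ h₂ H₂.measurable H₂.bounded f)] with x a b c d
      rw [a, d, Pi.add_apply, b, c, add_mul]
    rw [this, map_add]
    filter_upwards [H₁.comm _ _ e₁, H₂.comm _ _ e₂, Lp.coeFn_add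
      (S (mulLp μ h₁ H₁.measurable H₁.bounded f))
      (S (mulLp μ h₂ H₂.measurable H₂.bounded f))] with x a b c
    rw [c, Pi.add_apply, a, b, add_mul]

theorem mul (H₁ : CommutesMul S h₁) (H₂ : CommutesMul S h₂) :
    CommutesMul S (fun x => h₁ x * h₂ x) where
  measurable := H₁.measurable.mul H₂.measurable
  bounded := by
    obtain ⟨C₁, hC₁⟩ := H₁.bounded
    obtain ⟨C₂, hC₂⟩ := H₂.bounded
    refine ⟨C₁ * C₂, fun x => (norm_mul _ _).trans_le ?_⟩
    exact mul_le_mul (hC₁ x) (hC₂ x) (norm_nonneg _) ((norm_nonneg _).trans (hC₁ x))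
  comm f g hg := by
    have e₂ := coeFn_mulLp (μ := μ) H₂.measurable H₂.bounded f
    have e₁ : g =ᵐ[μ] fun x => h₁ x * mulLp μ h₂ H₂.measurable H₂.bounded f x := by
      filter_upwards [hg, e₂] with x a b
      rw [a, b, mul_assoc]
    filter_upwards [H₁.comm _ _ e₁, H₂.comm _ _ e₂] with x a b
    rw [a, b, mul_assoc]

theorem tendsto_inner_of_bounded {hn : ℕ → X → ℂ} {C : ℝ}
    (hC : ∀ n x, ‖hn n x‖ ≤ C) (hlim : ∀ x, Tendsto (fun n => hn n x) atTop (𝓝 (h x)))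
    {f g : Lp ℂ 2 μ} {gn : ℕ → Lp ℂ 2 μ} (hgn : ∀ n, gn n =ᵐ[μ] fun x => hn n x * f x)
    (hg : g =ᵐ[μ] fun x => h x * f x) (φ : Lp ℂ 2 μ) :
    Tendsto (fun n => inner ℂ φ (gn n)) atTop (𝓝 (inner ℂ φ g)) := by
  simp only [L2.inner_def]
  refine tendsto_integral_of_dominated_convergence (fun x => C * ‖inner ℂ (φ x) (f x)‖)
    (fun n => (L2.integrable_inner φ (gn n)).aestronglyMeasurable)
    ((L2.integrable_inner φ f).norm.const_mul C) (fun n => ?_) ?_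
  · filter_upwards [hgn n] with x hx
    rw [hx, ← smul_eq_mul, inner_smul_right, norm_mul]
    exact mul_le_mul_of_nonneg_right (hC n x) (norm_nonneg _)
  · filter_upwards [ae_all_iff.2 hgn, hg] with x hx hx'
    simp only [hx, hx', ← smul_eq_mul, inner_smul_right]
    exact (hlim x).mul tendsto_const_nhds

theorem of_tendsto {hn : ℕ → X → ℂ} {C : ℝ} (H : ∀ n, CommutesMul S (hn n))
    (hC : ∀ n x, ‖hn n x‖ ≤ C) (hlim : ∀ x, Tendsto (fun n => hn n x) atTop (𝓝 (h x))) :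
    CommutesMul S h where
  measurable := measurable_of_tendsto_metrizable (fun n => (H n).measurable)
    (tendsto_pi_nhds.2 hlim)
  bounded := ⟨C, fun x => le_of_tendsto (hlim x).norm (Eventually.of_forall fun n => hC n x)⟩
  comm f g hg := by
    have hm : Measurable h := measurable_of_tendsto_metrizable (fun n => (H n).measurable)
      (tendsto_pi_nhds.2 hlim)
    have hb : ∃ C, ∀ x, ‖h x‖ ≤ C :=
      ⟨C, fun x => le_of_tendsto (hlim x).norm (Eventually.of_forall fun n => hC n x)⟩
    have e : ∀ n, mulLp μ (hn n) (H n).measurable (H n).bounded f =ᵐ[μ] _ :=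
      fun n => coeFn_mulLp (H n).measurable (H n).bounded f
    have key : S g = mulLp μ h hm hb (S f) := by
      refine ext_inner_left ℂ fun φ => ?_
      have t₁ := tendsto_inner_of_bounded hC hlim e hg
        (ContinuousLinearMap.adjoint S φ)
      have t₂ := tendsto_inner_of_bounded hC hlim
        (fun n => (H n).comm _ _ (e n)) (coeFn_mulLp hm hb (S f)) φ
      simp only [ContinuousLinearMap.adjoint_inner_left] at t₁
      exact tendsto_nhds_unique t₁ t₂
    rw [key]
    exact coeFn_mulLp hm hb (S f)

theorem aeval {h : X → ℝ} (H : CommutesMul S (fun x => (h x : ℂ))) (p : Polynomial ℝ) :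
    CommutesMul S (fun x => ((p.eval (h x) : ℝ) : ℂ)) := by
  induction p using Polynomial.induction_on' with
  | add p q hp hq => simpa using hp.add hq
  | monomial n a =>
    have : CommutesMul S (fun x => (h x : ℂ) ^ n) := by
      induction n with
      | zero => simpa using const 1
      | succ n ih => simpa only [pow_succ] using ih.mul H
    simpa using (const (a : ℂ)).mul this

theorem comp_continuous {h : X → ℝ} (H : CommutesMul S (fun x => (h x : ℂ))) {φ : ℝ → ℝ}
    (hφ : Continuous φ) : CommutesMul S (fun x => ((φ (h x) : ℝ) : ℂ)) := by
  obtain ⟨C, hC⟩ := H.bounded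
  have hC' : ∀ x, h x ∈ Set.Icc (-C) C := fun x => by
    have := hC x
    rw [Complex.norm_real, Real.norm_eq_abs] at this
    exact abs_le.1 this
  have : ∀ n : ℕ, ∃ p : Polynomial ℝ, ∀ x ∈ Set.Icc (-C) C, |p.eval x - φ x| < 1 / ((n : ℝ) + 1) :=
    fun n => exists_polynomial_near_of_continuousOn (-C) C φ hφ.continuousOn _ (by positivity)
  choose p hp using this
  obtain ⟨D, hD⟩ := isCompact_Icc.exists_bound_of_continuousOn (s := Set.Icc (-C) C)
    hφ.continuousOn
  refine of_tendsto (C := D + 1) (fun n => H.aeval (p n)) (fun n x => ?_) (fun x => ?_)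
  · rw [Complex.norm_real]
    have h1 := hp n _ (hC' x)
    have h2 := hD _ (hC' x)
    have h3 : 1 / ((n : ℝ) + 1) ≤ 1 := by
      rw [div_le_one (by positivity)]
      linarith [(Nat.cast_nonneg n : (0 : ℝ) ≤ n)]
    have h4 := norm_add_le ((p n).eval (h x) - φ (h x)) (φ (h x))
    rw [sub_add_cancel] at h4
    rw [← Real.norm_eq_abs] at h1
    linarith
  · refine (Complex.continuous_ofReal.tendsto _).comp ?_
    rw [tendsto_iff_norm_sub_tendsto_zero]
    exact squeeze_zero (fun _ => norm_nonneg _) (fun n => (hp n _ (hC' x)).le)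
      tendsto_one_div_add_atTop_nhds_zero_nat

theorem indicator_lt {h : X → ℝ} (H : CommutesMul S (fun x => (h x : ℂ))) (a : ℝ) :
    CommutesMul S ({x | a < h x}.indicator 1) := by
  have hc : ∀ n : ℕ, Continuous fun t : ℝ => min 1 ((n : ℝ) * max 0 (t - a)) := fun n => by
    fun_prop
  refine of_tendsto (C := 1) (fun n => H.comp_continuous (hc n)) (fun n x => ?_) (fun x => ?_)
  · rw [Complex.norm_real, Real.norm_eq_abs, abs_of_nonneg]
    · exact min_le_left _ _
    · exact le_min zero_le_one (by positivity)
  · by_cases hx : a < h x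
    · rw [Set.indicator_of_mem (show x ∈ {x | a < h x} from hx)]
      refine tendsto_const_nhds.congr' ?_
      obtain ⟨N, hN⟩ := exists_nat_gt (1 / (h x - a))
      filter_upwards [eventually_ge_atTop N] with n hn
      have hpos : 0 < h x - a := sub_pos.2 hx
      have : 1 ≤ (n : ℝ) * max 0 (h x - a) := by
        rw [max_eq_right hpos.le]
        have h1 : 1 / (h x - a) ≤ n := hN.le.trans (by exact_mod_cast hn)
        rwa [div_le_iff₀ hpos] at h1
      rw [min_eq_left this]
      simp
    · rw [Set.indicator_of_notMem (show x ∉ {x | a < h x} from hx)]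
      refine tendsto_const_nhds.congr fun n => ?_
      rw [max_eq_left (by linarith)]
      simp

end CommutesMul

/-- The `σ`-algebra of all sets whose indicator functions commute with `S`. -/
@[reducible]
def commutingSigma (S : Lp ℂ 2 μ →L[ℂ] Lp ℂ 2 μ) : MeasurableSpace X where
  MeasurableSet' s := CommutesMul S (s.indicator 1)
  measurableSet_empty := by simpa using! CommutesMul.const (S := S) 0
  measurableSet_compl s hs := by
    have := (CommutesMul.const (S := S) 1).add ((CommutesMul.const (S := S) (-1)).mul hs)
    convert this using 2 with x
    by_cases hx : x ∈ s <;> simp [hx]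
  measurableSet_iUnion s hs := by
    have key : ∀ n : ℕ, CommutesMul S ((⋃ i < n, s i).indicator 1) := by
      intro n
      induction n with
      | zero => simpa using! CommutesMul.const (S := S) 0
      | succ n ih =>
        have := (ih.add (hs n)).add ((CommutesMul.const (S := S) (-1)).mul (ih.mul (hs n)))
        convert this using 2 with x
        rw [Set.biUnion_lt_succ]
        by_cases h1 : x ∈ ⋃ i < n, s i <;> by_cases h2 : x ∈ s n <;>
          simp only [Set.indicator, Set.mem_union, h1, h2] <;> simp
    refine CommutesMul.of_tendsto (C := 1) key (fun n x => ?_) (fun x => ?_)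
    · by_cases hx : x ∈ ⋃ i < n, s i
      · rw [Set.indicator_of_mem hx]; simp
      · rw [Set.indicator_of_notMem hx]; simp
    · by_cases hx : x ∈ ⋃ i, s i
      · rw [Set.indicator_of_mem hx]
        obtain ⟨i, hi⟩ := Set.mem_iUnion.1 hx
        refine tendsto_const_nhds.congr' ?_
        filter_upwards [eventually_gt_atTop i] with n hn
        rw [Set.indicator_of_mem (Set.mem_iUnion₂.2 ⟨i, hn, hi⟩)]
      · rw [Set.indicator_of_notMem hx]
        refine tendsto_const_nhds.congr fun n => ?_
        rw [Set.indicator_of_notMem]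
        intro h
        obtain ⟨i, -, hi⟩ := Set.mem_iUnion₂.1 h
        exact hx (Set.mem_iUnion.2 ⟨i, hi⟩)

theorem CommutesMul.measurable_commutingSigma {S : Lp ℂ 2 μ →L[ℂ] Lp ℂ 2 μ} {h : X → ℝ}
    (H : CommutesMul S (fun x => (h x : ℂ))) : Measurable[commutingSigma S] h :=
  measurable_of_Ioi (mδ := commutingSigma S) fun a => H.indicator_lt a

theorem commutesMul_of_measurable_commutingSigma {S : Lp ℂ 2 μ →L[ℂ] Lp ℂ 2 μ} {k : X → ℂ}
    (hk : Measurable[commutingSigma S] k) {C : ℝ} (hC : ∀ x, ‖k x‖ ≤ C) : CommutesMul S k := by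
  have hk' : StronglyMeasurable[commutingSigma S] k :=
    Measurable.stronglyMeasurable (mα := commutingSigma S) hk
  have hsimple : ∀ f : @SimpleFunc X (commutingSigma S) ℂ, CommutesMul S f := by
    intro f
    refine @SimpleFunc.induction X ℂ (commutingSigma S) _ (fun f => CommutesMul S f)
      (fun c s hs => ?_) (fun f g _ hf hg => ?_) f
    · have := (CommutesMul.const (S := S) c).mul (show CommutesMul S (s.indicator 1) from hs)
      convert this using 2 with x
      by_cases hx : x ∈ s <;> simp [hx]
    · exact hf.add hg
  exact CommutesMul.of_tendsto (C := C) (fun n => hsimple (hk'.approxBounded C n))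
    (fun n x => StronglyMeasurable.norm_approxBounded_le hk' ((norm_nonneg _).trans (hC x)) n x)
    (fun x => StronglyMeasurable.tendsto_approxBounded_of_norm_le hk' (hC x))

/-- A Borel function which is constant on the common level sets of countably many functions
commuting with `S` commutes with `S`. -/
theorem commutesMul_of_separating [StandardBorelSpace X] {S : Lp ℂ 2 μ →L[ℂ] Lp ℂ 2 μ}
    {ι : Type*} [Countable ι] {h : ι → X → ℝ} (H : ∀ i, CommutesMul S (fun x => (h i x : ℂ)))
    {k : X → ℂ} (hk : Measurable k) {C : ℝ} (hC : ∀ x, ‖k x‖ ≤ C)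
    (hsep : ∀ x y, (∀ i, h i x = h i y) → k x = k y) : CommutesMul S k := by
  refine commutesMul_of_measurable_commutingSigma ?_ hC
  let q : X → ι → ℝ := fun x i => h i x
  have hq : Measurable q := measurable_pi_lambda _ fun i =>
    Complex.measurable_re.comp (H i).measurable
  have hq' : Measurable[commutingSigma S] q :=
    @measurable_pi_lambda _ _ _ (commutingSigma S) _ _ fun i => (H i).measurable_commutingSigma
  intro B hB
  have hpre : q ⁻¹' (q '' (k ⁻¹' B)) = k ⁻¹' B := by
    refine subset_antisymm ?_ (Set.subset_preimage_image _ _)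
    rintro x ⟨y, hy, hyx⟩
    have : k y = k x := hsep y x fun i => congrFun hyx i
    rwa [Set.mem_preimage, ← this]
  have h1 : MeasurableSet (q ⁻¹' (q '' (k ⁻¹' B))) := by rw [hpre]; exact hk hB
  obtain ⟨t, ht, ht'⟩ := (hq.measurableSet_preimage_iff_preimage_val).1 h1
  have h2 : k ⁻¹' B = q ⁻¹' t := by
    rw [← hpre]
    ext x
    exact (Set.ext_iff.1 ht' ⟨q x, x, rfl⟩).symm
  rw [h2]
  exact hq' ht

end Multiplication

section Fourier

open FourierTransform SchwartzMap
open scoped RealInnerProductSpace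

variable {E : Type*} [NormedAddCommGroup E] [InnerProductSpace ℝ E]

/-- The character `x ↦ exp (2πi⟪b, x⟫)`. -/
def character (b x : E) : ℂ := (Real.fourierChar ⟪b, x⟫ : Circle)

theorem norm_character (b x : E) : ‖character b x‖ = 1 := Circle.norm_coe _

theorem bounded_character (b : E) : ∃ C, ∀ x, ‖character b x‖ ≤ C :=
  ⟨1, fun x => (norm_character b x).le⟩

theorem character_add (b x y : E) : character b (x + y) = character b x * character b y := by
  simp [character, inner_add_right, AddChar.map_add_eq_mul]

theorem character_comm (b x : E) : character b x = character x b := by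
  simp [character, real_inner_comm]

theorem character_neg_left (b x : E) : character (-b) x = star (character b x) := by
  simp [character, AddChar.map_neg_eq_inv]

theorem continuous_character (b : E) : Continuous (character b) := by
  unfold character
  fun_prop

variable [MeasurableSpace E] [BorelSpace E]

theorem measurable_character (b : E) : Measurable (character b) :=
  (continuous_character b).measurable

variable [FiniteDimensional ℝ E]

/-- The translation operator `f ↦ f (· - a)` on `L²`. -/
def translateLp (a : E) : Lp ℂ 2 (volume : Measure E) →L[ℂ] Lp ℂ 2 (volume : Measure E) :=
  (Lp.compMeasurePreservingₗᵢ ℂ (fun x => x - a)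
    (measurePreserving_sub_right volume a)).toContinuousLinearMap

theorem coeFn_translateLp (a : E) (f : Lp ℂ 2 (volume : Measure E)) :
    translateLp a f =ᵐ[volume] fun x => f (x - a) :=
  Lp.coeFn_compMeasurePreserving f (measurePreserving_sub_right volume a)

theorem ae_comp_sub {p : E → Prop} (h : ∀ᵐ x, p x) (a : E) : ∀ᵐ x, p (x - a) :=
  (measurePreserving_sub_right volume a).quasiMeasurePreserving.ae h

theorem translateLp_translateLp (a b : E) (f : Lp ℂ 2 (volume : Measure E)) :
    translateLp a (translateLp b f) = translateLp (a + b) f := by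
  apply Lp.ext
  filter_upwards [coeFn_translateLp a (translateLp b f), coeFn_translateLp (a + b) f,
    ae_comp_sub (coeFn_translateLp b f) a] with x h1 h2 h3
  rw [h1, h2, h3, sub_sub]

theorem translateLp_zero (f : Lp ℂ 2 (volume : Measure E)) : translateLp 0 f = f := by
  apply Lp.ext
  filter_upwards [coeFn_translateLp 0 f] with x h1
  rw [h1, sub_zero]

theorem translateLp_toLp (a : E) (f : 𝓢(E, ℂ)) :
    translateLp a (f.toLp 2) = (compSubConstCLM ℂ a f).toLp 2 := by
  apply Lp.ext
  filter_upwards [coeFn_translateLp a (f.toLp 2), (compSubConstCLM ℂ a f).coeFn_toLp 2,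
    ae_comp_sub (f.coeFn_toLp 2 volume) a] with x h1 h2 h3
  rw [h1, h2, h3]
  rfl

theorem fourier_translateLp (a : E) (f : Lp ℂ 2 (volume : Measure E)) :
    𝓕 (translateLp a f) =
      mulLp volume (character (-a)) (measurable_character _) (bounded_character _) (𝓕 f) := by
  refine DenseRange.induction_on (p := fun f => 𝓕 (translateLp a f) =
      mulLp volume (character (-a)) (measurable_character _) (bounded_character _) (𝓕 f))
    (denseRange_toLpCLM (p := 2) ENNReal.ofNat_ne_top) f ?_ ?_
  · have := (Lp.fourierTransformₗᵢ E ℂ).continuous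
    exact isClosed_eq (this.comp (translateLp a).continuous)
      ((mulLp volume _ _ _).continuous.comp this)
  · intro f
    simp only [toLpCLM_apply]
    rw [translateLp_toLp, toLp_fourier_eq, toLp_fourier_eq]
    apply Lp.ext
    filter_upwards [(𝓕 (compSubConstCLM ℂ a f)).coeFn_toLp 2, coeFn_mulLp (measurable_character _)
      (bounded_character (-a)) ((𝓕 f).toLp 2), (𝓕 f).coeFn_toLp 2] with ξ h1 h2 h3
    rw [h1, h2, h3, fourier_coe, fourier_coe, Real.fourier_eq, Real.fourier_eq,
      ← integral_const_mul, ← integral_add_right_eq_self _ a]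
    congr 1 with x
    rw [compSubConstCLM_apply, add_sub_cancel_right, Circle.smul_def, Circle.smul_def,
      smul_eq_mul, smul_eq_mul, ← mul_assoc]
    congr 1
    rw [character, ← Circle.coe_mul, ← AddChar.map_add_eq_mul]
    congr 2
    rw [inner_add_left, inner_neg_left]
    ring

theorem fourierInv_translateLp (a : E) (f : Lp ℂ 2 (volume : Measure E)) :
    𝓕⁻ (translateLp a f) =
      mulLp volume (character a) (measurable_character _) (bounded_character _) (𝓕⁻ f) := by
  refine DenseRange.induction_on (p := fun f => 𝓕⁻ (translateLp a f) =
      mulLp volume (character a) (measurable_character _) (bounded_character _) (𝓕⁻ f))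
    (denseRange_toLpCLM (p := 2) ENNReal.ofNat_ne_top) f ?_ ?_
  · have := (Lp.fourierTransformₗᵢ E ℂ).symm.continuous
    exact isClosed_eq (this.comp (translateLp a).continuous)
      ((mulLp volume _ _ _).continuous.comp this)
  · intro f
    simp only [toLpCLM_apply]
    rw [translateLp_toLp, toLp_fourierInv_eq, toLp_fourierInv_eq]
    apply Lp.ext
    filter_upwards [(𝓕⁻ (compSubConstCLM ℂ a f)).coeFn_toLp 2, coeFn_mulLp (measurable_character _)
      (bounded_character a) ((𝓕⁻ f).toLp 2), (𝓕⁻ f).coeFn_toLp 2] with ξ h1 h2 h3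
    rw [h1, h2, h3, fourierInv_coe, fourierInv_coe, Real.fourierInv_eq, Real.fourierInv_eq,
      ← integral_const_mul, ← integral_add_right_eq_self _ a]
    congr 1 with x
    rw [compSubConstCLM_apply, add_sub_cancel_right, Circle.smul_def, Circle.smul_def,
      smul_eq_mul, smul_eq_mul, ← mul_assoc]
    congr 1
    rw [character, ← Circle.coe_mul, ← AddChar.map_add_eq_mul]
    congr 2
    rw [inner_add_left]
    ring

/-- The operator `S` conjugated by the Fourier transform. -/
def fourierConj (S : Lp ℂ 2 (volume : Measure E) →L[ℂ] Lp ℂ 2 (volume : Measure E)) :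
    Lp ℂ 2 (volume : Measure E) →L[ℂ] Lp ℂ 2 (volume : Measure E) :=
  (Lp.fourierTransformₗᵢ E ℂ).toContinuousLinearEquiv.toContinuousLinearMap ∘L S ∘L
    (Lp.fourierTransformₗᵢ E ℂ).symm.toContinuousLinearEquiv.toContinuousLinearMap

theorem fourierConj_apply (S : Lp ℂ 2 (volume : Measure E) →L[ℂ] Lp ℂ 2 (volume : Measure E))
    (f : Lp ℂ 2 (volume : Measure E)) : fourierConj S f = 𝓕 (S (𝓕⁻ f)) := rfl

theorem commutesMul_fourierConj
    {S : Lp ℂ 2 (volume : Measure E) →L[ℂ] Lp ℂ 2 (volume : Measure E)} {a : E}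
    (h : ∀ f, S (translateLp (-a) f) = translateLp (-a) (S f)) :
    CommutesMul (fourierConj S) (character a) where
  measurable := measurable_character a
  bounded := bounded_character a
  comm f g hg := by
    have key : ∀ f : Lp ℂ 2 (volume : Measure E), mulLp volume (character a)
        (measurable_character _) (bounded_character _) f = 𝓕 (translateLp (-a) (𝓕⁻ f)) := by
      intro f
      rw [fourier_translateLp, fourier_fourierInv_eq]
      simp only [neg_neg]
    have hg' : g = 𝓕 (translateLp (-a) (𝓕⁻ f)) := by
      rw [← key]
      exact Lp.ext (hg.trans (coeFn_mulLp _ _ f).symm)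
    rw [hg', fourierConj_apply, fourierInv_fourier_eq, h]
    have : 𝓕 (translateLp (-a) (S (𝓕⁻ f))) = mulLp volume (character a)
        (measurable_character _) (bounded_character _) (fourierConj S f) := by
      rw [key, fourierConj_apply, fourierInv_fourier_eq]
    rw [this]
    exact coeFn_mulLp _ _ _

theorem fourierConj_translateLp
    {S : Lp ℂ 2 (volume : Measure E) →L[ℂ] Lp ℂ 2 (volume : Measure E)} {b : E}
    (h : CommutesMul S (character b)) (f : Lp ℂ 2 (volume : Measure E)) :
    fourierConj S (translateLp b f) = translateLp b (fourierConj S f) := by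
  have key : ∀ f, S (mulLp volume (character b) (measurable_character _) (bounded_character _) f) =
      mulLp volume (character b) (measurable_character _) (bounded_character _) (S f) := fun f =>
    Lp.ext ((h.comm _ _ (coeFn_mulLp _ _ f)).trans (coeFn_mulLp _ _ (S f)).symm)
  have hinj : Function.Injective
      (fun f : Lp ℂ 2 (volume : Measure E) => (𝓕⁻ f : Lp ℂ 2 (volume : Measure E))) :=
    (Lp.fourierTransformₗᵢ E ℂ).symm.injective
  apply hinj
  simp only [fourierConj_apply]
  rw [fourierInv_translateLp, fourierInv_translateLp, key, fourierInv_fourier_eq, fourierInv_fourier_eq]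

end Fourier

theorem exists_lp_two_ne_zero {X : Type*} [MeasurableSpace X] (μ : Measure X) [SigmaFinite μ] :
    ∃ g : Lp ℂ 2 μ, ∀ᵐ x ∂μ, g x ≠ 0 := by
  obtain ⟨g, hpos, hm, hint⟩ := exists_pos_lintegral_lt_of_sigmaFinite μ one_ne_zero
  have hmeas : Measurable fun x => ((Real.sqrt (g x) : ℝ) : ℂ) := by fun_prop
  have hmem : MemLp (fun x => ((Real.sqrt (g x) : ℝ) : ℂ)) 2 μ := by
    rw [memLp_two_iff_integrable_sq_norm hmeas.aestronglyMeasurable]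
    have : (fun x => ‖((Real.sqrt (g x) : ℝ) : ℂ)‖ ^ 2) = fun x => (g x : ℝ) := by
      ext x
      rw [Complex.norm_real, Real.norm_eq_abs, sq_abs, Real.sq_sqrt (g x).coe_nonneg]
    rw [this]
    refine ⟨hm.coe_nnreal_real.aestronglyMeasurable, ?_⟩
    have h1 : ∀ x, ‖(g x : ℝ)‖ₑ = g x := fun x => by simp [enorm_eq_nnnorm]
    simp only [HasFiniteIntegral, h1]
    exact hint.trans ENNReal.one_lt_top
  refine ⟨hmem.toLp _, ?_⟩
  filter_upwards [hmem.coeFn_toLp] with x hx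
  rw [hx]
  simpa using (hpos x).ne'

section

variable {X : Type*}

theorem norm_indicator_one_le (s : Set X) (x : X) : ‖s.indicator (1 : X → ℂ) x‖ ≤ 1 := by
  by_cases hx : x ∈ s <;> simp [hx]

variable [MeasurableSpace X] {μ : Measure X}

/-- An operator commuting with all bounded multiplications satisfies `f * S g = g * S f`. -/
theorem mul_apply_eq_of_commutesMul {S : Lp ℂ 2 μ →L[ℂ] Lp ℂ 2 μ}
    (hS : ∀ k : X → ℂ, Measurable k → ∀ C : ℝ, (∀ x, ‖k x‖ ≤ C) → CommutesMul S k)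
    (f g : Lp ℂ 2 μ) : ∀ᵐ x ∂μ, f x * S g x = g x * S f x := by
  have hf : Measurable f := (Lp.stronglyMeasurable f).measurable
  have hg : Measurable g := (Lp.stronglyMeasurable g).measurable
  have key : ∀ n : ℕ, ∀ᵐ x ∂μ, ‖f x‖ ≤ n → ‖g x‖ ≤ n → f x * S g x = g x * S f x := by
    intro n
    let s : Set X := {x | ‖f x‖ ≤ n ∧ ‖g x‖ ≤ n}
    have hs : MeasurableSet s := (measurableSet_le hf.norm measurable_const).inter
      (measurableSet_le hg.norm measurable_const)
    have hbf : ∀ x, ‖s.indicator f x‖ ≤ n := fun x => by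
      by_cases hx : x ∈ s
      · rw [Set.indicator_of_mem hx]; exact hx.1
      · rw [Set.indicator_of_notMem hx]; simp
    have hbg : ∀ x, ‖s.indicator g x‖ ≤ n := fun x => by
      by_cases hx : x ∈ s
      · rw [Set.indicator_of_mem hx]; exact hx.2
      · rw [Set.indicator_of_notMem hx]; simp
    have Hf := hS _ (hf.indicator hs) n hbf
    have Hg := hS _ (hg.indicator hs) n hbg
    have e₁ := coeFn_mulLp (μ := μ) Hf.measurable Hf.bounded g
    have e₂ : mulLp μ _ Hf.measurable Hf.bounded g =ᵐ[μ] fun x => s.indicator g x * f x := by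
      filter_upwards [e₁] with x hx
      rw [hx]
      by_cases hxs : x ∈ s
      · rw [Set.indicator_of_mem hxs, Set.indicator_of_mem hxs, mul_comm]
      · rw [Set.indicator_of_notMem hxs, Set.indicator_of_notMem hxs, zero_mul, zero_mul]
    filter_upwards [Hf.comm _ _ e₁, Hg.comm _ _ e₂] with x h1 h2 h3 h4
    rw [h1, Set.indicator_of_mem (show x ∈ s from ⟨h3, h4⟩),
      Set.indicator_of_mem (show x ∈ s from ⟨h3, h4⟩)] at h2
    exact h2
  filter_upwards [ae_all_iff.2 key] with x hx
  obtain ⟨n, hn⟩ := exists_nat_ge (max ‖f x‖ ‖g x‖)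
  exact hx n ((le_max_left _ _).trans hn) ((le_max_right _ _).trans hn)

end

section Invariance

variable {E : Type*} [NormedAddCommGroup E] [InnerProductSpace ℝ E]

theorem eq_of_character_sub_eq_one {x y : E} (h : ∀ b, character b (x - y) = 1) : x = y := by
  by_contra hne
  have hw : ‖x - y‖ ≠ 0 := norm_ne_zero_iff.2 (sub_ne_zero.2 hne)
  have h1 := h ((1 / (2 * ‖x - y‖ ^ 2)) • (x - y))
  have h2 : inner ℝ ((1 / (2 * ‖x - y‖ ^ 2)) • (x - y)) (x - y) = 1 / 2 := by
    rw [real_inner_smul_left, real_inner_self_eq_norm_sq]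
    field_simp
  rw [character, h2, Real.fourierChar_apply] at h1
  have h3 : ((2 * Real.pi * (1 / 2) : ℝ) : ℂ) * Complex.I = Real.pi * Complex.I := by
    push_cast; ring
  rw [h3, Complex.exp_pi_mul_I] at h1
  norm_num at h1

variable [MeasurableSpace E] [BorelSpace E] [FiniteDimensional ℝ E]

theorem CommutesMul.character_re {S : Lp ℂ 2 (volume : Measure E) →L[ℂ] Lp ℂ 2 (volume : Measure E)}
    {a : E} (h : CommutesMul S (character a)) (h' : CommutesMul S (character (-a))) :
    CommutesMul S (fun x => ((character a x).re : ℂ)) := by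
  have := (CommutesMul.const (1 / 2)).mul (h.add h')
  convert this using 2 with x
  rw [character_neg_left, Complex.star_def, Complex.re_eq_add_conj]
  ring

theorem CommutesMul.character_im {S : Lp ℂ 2 (volume : Measure E) →L[ℂ] Lp ℂ 2 (volume : Measure E)}
    {a : E} (h : CommutesMul S (character a)) (h' : CommutesMul S (character (-a))) :
    CommutesMul S (fun x => ((character a x).im : ℂ)) := by
  have := (CommutesMul.const (1 / (2 * Complex.I))).mul
    (h.add ((CommutesMul.const (-1)).mul h'))
  convert this using 2 with x
  rw [character_neg_left, Complex.star_def, Complex.im_eq_sub_conj]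
  ring

theorem commutesMul_of_character
    {S : Lp ℂ 2 (volume : Measure E) →L[ℂ] Lp ℂ 2 (volume : Measure E)} {G : Set E}
    (hG : ∀ z ∈ G, -z ∈ G) (h : ∀ z ∈ G, CommutesMul S (character z)) {k : E → ℂ}
    (hk : Measurable k) {C : ℝ} (hC : ∀ x, ‖k x‖ ≤ C)
    (hinv : ∀ x y, (∀ z ∈ G, character z (x - y) = 1) → k x = k y) : CommutesMul S k := by
  obtain ⟨c, hcG, hc, hcd⟩ :=
    (TopologicalSpace.IsSeparable.of_separableSpace G).exists_countable_dense_subset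
  have : Countable c := hc.to_subtype
  refine commutesMul_of_separating (ι := c ⊕ c)
    (h := Sum.elim (fun z x => (character (z : E) x).re) (fun z x => (character (z : E) x).im))
    ?_ hk hC ?_
  · rintro (z | z)
    · exact (h z (hcG z.2)).character_re (h _ (hG z (hcG z.2)))
    · exact (h z (hcG z.2)).character_im (h _ (hG z (hcG z.2)))
  · intro x y hxy
    refine hinv x y fun z hz => ?_
    have hcl : IsClosed {z : E | character z (x - y) = 1} := by
      simp only [fun z => character_comm z (x - y)]
      exact isClosed_eq (continuous_character _) continuous_const
    refine hcl.closure_subset_iff.2 (fun w hw => ?_) (hcd hz)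
    have h1 : character w x = character w y :=
      Complex.ext (hxy (Sum.inl ⟨w, hw⟩)) (hxy (Sum.inr ⟨w, hw⟩))
    have h2 := character_add w (x - y) y
    rw [sub_add_cancel, h1] at h2
    have h3 : character w y ≠ 0 := norm_ne_zero_iff.1 (by rw [norm_character]; exact one_ne_zero)
    exact (mul_right_cancel₀ h3 (by rw [← h2, one_mul]))

theorem setAverage_closedBall_add (k : E → ℂ) (x : E) (r : ℝ) :
    ⨍ y in Metric.closedBall x r, k y = ⨍ y in Metric.closedBall 0 r, k (x + y) := by
  have hpre : (fun y => x + y) ⁻¹' Metric.closedBall x r = Metric.closedBall 0 r := by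
    ext y
    simp
  rw [setAverage_eq, setAverage_eq, ← hpre,
    (measurePreserving_add_left volume x).setIntegral_preimage_emb
      (measurableEmbedding_addLeft x), measureReal_def, measureReal_def,
    (measurePreserving_add_left volume x).measure_preimage
      Metric.isClosed_closedBall.measurableSet.nullMeasurableSet]

theorem exists_invariant_modification {k : E → ℂ} (hk : Measurable k) {C : ℝ}
    (hC : ∀ x, ‖k x‖ ≤ C) :
    ∃ k' : E → ℂ, Measurable k' ∧ (∀ x, ‖k' x‖ ≤ C) ∧ k' =ᵐ[volume] k ∧
      ∀ b, (∀ᵐ x, k (x - b) = k x) → ∀ x, k' (x - b) = k' x := by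
  let a : ℕ → E → ℂ := fun n x => ⨍ y in Metric.closedBall 0 (1 / ((n : ℝ) + 1)), k (x + y)
  have ha : ∀ n, Measurable (a n) := fun n => by
    have h1 : StronglyMeasurable (Function.uncurry fun x y : E => k (x + y)) :=
      (hk.comp (measurable_fst.add measurable_snd)).stronglyMeasurable
    have h2 := h1.integral_prod_right
      (ν := volume.restrict (Metric.closedBall (0 : E) (1 / ((n : ℝ) + 1))))
    simp only [a, setAverage_eq]
    exact h2.measurable.const_smul _
  let l : E → ℂ := fun x => (limsup (fun n => (a n x).re) atTop : ℝ) +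
    (limsup (fun n => (a n x).im) atTop : ℝ) * Complex.I
  have hl : Measurable l := by
    have h1 : Measurable fun x => limsup (fun n => (a n x).re) atTop :=
      Measurable.limsup fun n => Complex.measurable_re.comp (ha n)
    have h2 : Measurable fun x => limsup (fun n => (a n x).im) atTop :=
      Measurable.limsup fun n => Complex.measurable_im.comp (ha n)
    exact (Complex.measurable_ofReal.comp h1).add
      ((Complex.measurable_ofReal.comp h2).mul_const _)
  have hint : LocallyIntegrable k volume :=
    (memLp_top_of_bound hk.aestronglyMeasurable C (Eventually.of_forall hC)).locallyIntegrable
      le_top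
  have hlk : l =ᵐ[volume] k := by
    filter_upwards [IsUnifLocDoublingMeasure.ae_tendsto_average volume hint 1] with x hx
    have h1 : Tendsto (fun n : ℕ => 1 / ((n : ℝ) + 1)) atTop (𝓝[>] 0) :=
      tendsto_nhdsWithin_iff.2 ⟨tendsto_one_div_add_atTop_nhds_zero_nat,
        Eventually.of_forall fun n => by simp only [Set.mem_Ioi]; positivity⟩
    have h2 : Tendsto (fun n => a n x) atTop (𝓝 (k x)) :=
      (hx (fun _ : ℕ => x) _ h1 (Eventually.of_forall fun n => by
        simp only [Metric.mem_closedBall, dist_self]; positivity)).congr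
        fun n => setAverage_closedBall_add k x _
    have h3 := ((Complex.continuous_re.tendsto _).comp h2).limsup_eq
    have h4 := ((Complex.continuous_im.tendsto _).comp h2).limsup_eq
    simp only [l]
    simp only [Function.comp_def] at h3 h4
    rw [h3, h4, Complex.re_add_im]
  refine ⟨{x | ‖l x‖ ≤ C}.indicator l,
    hl.indicator (measurableSet_le hl.norm measurable_const), fun x => ?_, ?_, fun b hb => ?_⟩
  · by_cases hx : x ∈ {x | ‖l x‖ ≤ C}
    · rw [Set.indicator_of_mem hx]; exact hx
    · rw [Set.indicator_of_notMem hx, norm_zero]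
      exact (norm_nonneg _).trans (hC x)
  · filter_upwards [hlk] with x hx
    rw [Set.indicator_of_mem (show x ∈ {x | ‖l x‖ ≤ C} from (congrArg norm hx).trans_le (hC x)), hx]
  · have hab : ∀ n x, a n (x - b) = a n x := fun n x => by
      simp only [a, setAverage_eq]
      congr 1
      refine integral_congr_ae (ae_restrict_of_ae ?_)
      filter_upwards [(measurePreserving_add_left volume x).quasiMeasurePreserving.ae hb] with y hy
      rw [← hy]
      congr 1
      abel
    have hlb : ∀ x, l (x - b) = l x := fun x => by simp only [l, hab]
    intro x
    simp only [Set.indicator, Set.mem_ofPred_eq, hlb]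

theorem ae_mul_of_ae_invariant
    {S : Lp ℂ 2 (volume : Measure E) →L[ℂ] Lp ℂ 2 (volume : Measure E)} {G : Set E}
    (hG : ∀ z ∈ G, -z ∈ G) (h : ∀ z ∈ G, CommutesMul S (character z)) {k : E → ℂ}
    (hk : Measurable k) {C : ℝ} (hC : ∀ x, ‖k x‖ ≤ C)
    (hinv : ∀ b, (∀ z ∈ G, character b z = 1) → ∀ᵐ x, k (x - b) = k x)
    {f g : Lp ℂ 2 (volume : Measure E)} (hg : g =ᵐ[volume] fun x => k x * f x) :
    S g =ᵐ[volume] fun x => k x * S f x := by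
  obtain ⟨k', hk', hC', hkk', hinv'⟩ := exists_invariant_modification hk hC
  have H : CommutesMul S k' := by
    refine commutesMul_of_character hG h hk' hC' fun x y hxy => ?_
    have := hinv' (x - y) (hinv _ fun z hz => by rw [character_comm]; exact hxy z hz) x
    rw [← this, sub_sub_cancel]
  have hg' : g =ᵐ[volume] fun x => k' x * f x := by
    filter_upwards [hg, hkk'] with x h1 h2
    rw [h1, h2]
  filter_upwards [H.comm f g hg', hkk'] with x h1 h2
  rw [h1, h2]

/-- An operator commuting with all translations and with all characters trivial on `G` commutes
with every operator commuting with the translations by elements of `G`. -/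
theorem commute_of_translation_invariant {G : Set E} (hG : ∀ z ∈ G, -z ∈ G)
    {t r : Lp ℂ 2 (volume : Measure E) →L[ℂ] Lp ℂ 2 (volume : Measure E)}
    (ht : ∀ a f, t (translateLp a f) = translateLp a (t f))
    (htc : ∀ b, (∀ z ∈ G, character b z = 1) → CommutesMul t (character b))
    (hr : ∀ z ∈ G, ∀ f, r (translateLp z f) = translateLp z (r f))
    (f : Lp ℂ 2 (volume : Measure E)) : t (r f) = r (t f) := by
  have hS : ∀ k : E → ℂ, Measurable k → ∀ C : ℝ, (∀ x, ‖k x‖ ≤ C) →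
      CommutesMul (fourierConj t) k := fun k hk C hC =>
    commutesMul_of_character (G := Set.univ) (fun _ _ => trivial)
      (fun z _ => commutesMul_fourierConj (ht (-z))) hk hC
      fun x y hxy => by rw [eq_of_character_sub_eq_one fun b => hxy b trivial]
  have hR : ∀ z ∈ G, CommutesMul (fourierConj r) (character z) := fun z hz =>
    commutesMul_fourierConj (hr (-z) (hG z hz))
  obtain ⟨g, hg⟩ := exists_lp_two_ne_zero (volume : Measure E)
  let m : E → ℂ := fun x => fourierConj t g x / g x
  have hm : Measurable m := (Lp.stronglyMeasurable _).measurable.div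
    (Lp.stronglyMeasurable _).measurable
  have hmul : ∀ f : Lp ℂ 2 (volume : Measure E),
      fourierConj t f =ᵐ[volume] fun x => m x * f x := fun f => by
    filter_upwards [mul_apply_eq_of_commutesMul hS f g, hg] with x h1 h2
    simp only [m]
    rw [div_mul_eq_mul_div, eq_div_iff h2, mul_comm, ← h1, mul_comm]
  have hminv : ∀ b, (∀ z ∈ G, character b z = 1) → ∀ᵐ x, m (x - b) = m x := fun b hb => by
    have h1 := fourierConj_translateLp (htc b hb) g
    filter_upwards [hmul (translateLp b g), coeFn_translateLp b g,
      coeFn_translateLp b (fourierConj t g), ae_comp_sub (hmul g) b, ae_comp_sub hg b]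
      with x h2 h3 h4 h5 h6
    rw [h1, h4, h5, h3] at h2
    exact mul_right_cancel₀ h6 h2
  have key : ∀ f : Lp ℂ 2 (volume : Measure E),
      fourierConj r (fourierConj t f) = fourierConj t (fourierConj r f) := by
    intro f
    apply Lp.ext
    have hn : ∀ n : ℕ, ∀ᵐ x, ‖m x‖ ≤ n →
        fourierConj r (fourierConj t f) x = fourierConj t (fourierConj r f) x := by
      intro n
      let s : Set E := {x | ‖m x‖ ≤ n}
      have hs : MeasurableSet s := measurableSet_le hm.norm measurable_const
      have h1 : Measurable (s.indicator (1 : E → ℂ)) := measurable_one.indicator hs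
      have hb : ∀ x, ‖s.indicator m x‖ ≤ n := fun x => by
        by_cases hx : x ∈ s
        · rw [Set.indicator_of_mem hx]; exact hx
        · rw [Set.indicator_of_notMem hx]; simp
      have e := coeFn_mulLp (μ := volume) h1 ⟨1, norm_indicator_one_le s⟩ (fourierConj t f)
      have e' : mulLp volume _ h1 ⟨1, norm_indicator_one_le s⟩ (fourierConj t f) =ᵐ[volume]
          fun x => s.indicator m x * f x := by
        filter_upwards [e, hmul f] with x h2 h3
        rw [h2, h3]
        by_cases hx : x ∈ s <;> simp [hx]
      have r₁ := ae_mul_of_ae_invariant hG hR h1 (norm_indicator_one_le s) (fun b hb => by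
        filter_upwards [hminv b hb] with x hx
        simp only [Set.indicator, s, Set.mem_ofPred_eq, hx, Pi.one_apply]) e
      have r₂ := ae_mul_of_ae_invariant hG hR (hm.indicator hs) hb
        (fun b hb => by
          filter_upwards [hminv b hb] with x hx
          simp only [Set.indicator, s, Set.mem_ofPred_eq, hx]) e'
      filter_upwards [r₁, r₂, hmul (fourierConj r f)] with x h2 h3 h4 h5
      rw [h2, Set.indicator_of_mem (show x ∈ s from h5),
        Set.indicator_of_mem (show x ∈ s from h5), Pi.one_apply, one_mul] at h3
      rw [h3, h4]
    filter_upwards [ae_all_iff.2 hn] with x hx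
    obtain ⟨n, hn⟩ := exists_nat_ge ‖m x‖
    exact hx n hn
  have h1 := key ((Lp.fourierTransformₗᵢ E ℂ) f)
  have h2 : ∀ (S : Lp ℂ 2 (volume : Measure E) →L[ℂ] Lp ℂ 2 (volume : Measure E)) f,
      fourierConj S ((Lp.fourierTransformₗᵢ E ℂ) f) = (Lp.fourierTransformₗᵢ E ℂ) (S f) :=
    fun S f => congrArg (fun f => (Lp.fourierTransformₗᵢ E ℂ) (S f))
      ((Lp.fourierTransformₗᵢ E ℂ).symm_apply_apply f)
  rw [h2, h2, h2, h2] at h1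
  exact ((Lp.fourierTransformₗᵢ E ℂ).injective h1).symm

end Invariance

section Cone

variable {E : Type*} [NormedAddCommGroup E] [NormedSpace ℝ E] {P A : Set E}

theorem Convex.interior_nonempty_of_forall_eq_sub [FiniteDimensional ℝ E] (hP : Convex ℝ P)
    (hspan : ∀ v, ∃ x ∈ P, ∃ y ∈ P, v = x - y) : (interior P).Nonempty := by
  obtain ⟨x₀, hx₀, -⟩ := hspan 0
  rw [hP.interior_nonempty_iff_affineSpan_eq_top,
    AffineSubspace.affineSpan_eq_top_iff_vectorSpan_eq_top_of_nonempty ℝ E E ⟨x₀, hx₀⟩, eq_top_iff]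
  rintro v -
  obtain ⟨x, hx, y, hy, rfl⟩ := hspan v
  exact vsub_mem_vectorSpan ℝ hx hy

theorem eventually_nsmul_add_mem (hcone : ∀ x ∈ P, ∀ t : ℝ, 0 ≤ t → t • x ∈ P) {p : E}
    (hp : p ∈ interior P) (v : E) : ∀ᶠ n : ℕ in atTop, n • p + v ∈ P := by
  have h1 : Tendsto (fun n : ℕ => p + (1 / ((n : ℝ))) • v) atTop (𝓝 (p + (0 : ℝ) • v)) :=
    tendsto_const_nhds.add (tendsto_one_div_atTop_nhds_zero_nat.smul_const v)
  rw [zero_smul, add_zero] at h1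
  filter_upwards [h1.eventually (isOpen_interior.mem_nhds hp), eventually_gt_atTop 0] with n h2 h3
  have h4 := hcone _ (interior_subset h2) n n.cast_nonneg
  have h5 : (n : ℝ) ≠ 0 := Nat.cast_ne_zero.mpr (ne_of_gt h3)
  rwa [smul_add, smul_smul, mul_one_div_cancel h5, one_smul, Nat.cast_smul_eq_nsmul] at h4

/-- A translation under which membership in `A` is unchanged along a dense set preserves `A`. -/
theorem image_add_eq_of_dense (hP : Convex ℝ P) (h0 : 0 ∈ P) (hint : (interior P).Nonempty)
    (hA : IsClosed A) (hAmod : ∀ b ∈ A, ∀ p ∈ P, b + p ∈ A) {D : Set E} (hD : Dense D) {x y : E}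
    (h : ∀ q ∈ D, x + q ∈ A ↔ y + q ∈ A) : (fun b => b + (x - y)) '' A = A := by
  have key : ∀ {x y : E}, (∀ q ∈ D, x + q ∈ A ↔ y + q ∈ A) → ∀ b ∈ A, b + (x - y) ∈ A := by
    intro x y h b hb
    have hcl : (0 : E) ∈ closure (interior P) := by
      rw [hP.closure_interior_eq_closure_of_nonempty_interior hint]
      exact subset_closure h0
    have hcl' : (0 : E) ∈ closure (interior P ∩ (fun w => b - y + w) ⁻¹' D) := by
      have := (hD.preimage (Homeomorph.addLeft (b - y)).isOpenMap).open_subset_closure_inter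
        (isOpen_interior (s := P))
      exact closure_minimal this isClosed_closure hcl
    have hsub : interior P ∩ (fun w => b - y + w) ⁻¹' D ⊆ (fun w => b + (x - y) + w) ⁻¹' A := by
      rintro w ⟨hw, hwD⟩
      have h1 := (h _ hwD).2 (by
        have := hAmod b hb w (interior_subset hw)
        rwa [show y + (b - y + w) = b + w by abel])
      rwa [show x + (b - y + w) = b + (x - y) + w by abel] at h1
    have h2 := (closure_minimal hsub (hA.preimage (by fun_prop))) hcl'
    simpa using h2
  refine Set.Subset.antisymm ?_ fun b hb => ⟨b + (y - x), ?_, by simp only; abel⟩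
  · rintro _ ⟨b, hb, rfl⟩
    exact key h b hb
  · exact key (fun q hq => (h q hq).symm) b hb

end Cone

section Dilation

variable {E : Type*} [NormedAddCommGroup E] [MeasurableSpace E] [BorelSpace E] {A : Set E}

theorem measurable_indicator_add (hA : IsClosed A) (a : E) :
    Measurable (((fun x => x + a) ⁻¹' A).indicator (1 : E → ℂ)) :=
  measurable_one.indicator ((hA.preimage (by fun_prop)).measurableSet)

variable [InnerProductSpace ℝ E] [FiniteDimensional ℝ E]

/-- The projection of `L²` onto the functions supported in `A - a`. -/
def cutoff (hA : IsClosed A) (a : E) :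
    Lp ℂ 2 (volume : Measure E) →L[ℂ] Lp ℂ 2 (volume : Measure E) :=
  mulLp volume (((fun x => x + a) ⁻¹' A).indicator 1) (measurable_indicator_add hA a)
    ⟨1, norm_indicator_one_le _⟩

theorem coeFn_cutoff (hA : IsClosed A) (a : E) (f : Lp ℂ 2 (volume : Measure E)) :
    cutoff hA a f =ᵐ[volume] fun x => ((fun x => x + a) ⁻¹' A).indicator 1 x * f x :=
  coeFn_mulLp _ _ f

theorem cutoff_translateLp (hA : IsClosed A) (a b : E) (f : Lp ℂ 2 (volume : Measure E)) :
    cutoff hA a (translateLp b f) = translateLp b (cutoff hA (a + b) f) := by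
  apply Lp.ext
  filter_upwards [coeFn_cutoff hA a (translateLp b f), coeFn_translateLp b f,
    coeFn_translateLp b (cutoff hA (a + b) f), ae_comp_sub (coeFn_cutoff hA (a + b) f) b]
    with x h1 h2 h3 h4
  rw [h1, h2, h3, h4]
  congr 1
  have h5 : x - b + (a + b) = x + a := by abel
  by_cases hx : x + a ∈ A
  · rw [Set.indicator_of_mem (show x ∈ (fun x => x + a) ⁻¹' A from hx), Set.indicator_of_mem
      (show x - b ∈ (fun x => x + (a + b)) ⁻¹' A from Set.mem_preimage.2 (h5.symm ▸ hx))]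
    rfl
  · rw [Set.indicator_of_notMem (show x ∉ (fun x => x + a) ⁻¹' A from hx), Set.indicator_of_notMem
      (show x - b ∉ (fun x => x + (a + b)) ⁻¹' A from fun h => hx (h5 ▸ Set.mem_preimage.1 h))]

theorem commutesMul_indicator_of_cutoff (hA : IsClosed A) (a : E)
    {t : Lp ℂ 2 (volume : Measure E) →L[ℂ] Lp ℂ 2 (volume : Measure E)}
    (h : ∀ f, t (cutoff hA a f) = cutoff hA a (t f)) :
    CommutesMul t (((fun x => x + a) ⁻¹' A).indicator 1) where
  measurable := measurable_indicator_add hA a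
  bounded := ⟨1, norm_indicator_one_le _⟩
  comm f g hg := by
    rw [show g = cutoff hA a f from Lp.ext (hg.trans (coeFn_cutoff hA a f).symm), h]
    exact coeFn_cutoff hA a (t f)

theorem tendsto_cutoff (hA : IsClosed A) {a : ℕ → E} (ha : ∀ x, ∀ᶠ n in atTop, x + a n ∈ A)
    (f : Lp ℂ 2 (volume : Measure E)) :
    Tendsto (fun n => cutoff hA (a n) f) atTop (𝓝 f) := by
  have hx : ∀ n, ∀ᵐ x, (cutoff hA (a n) f - f : Lp ℂ 2 (volume : Measure E)) x =
      ((fun x => x + a n) ⁻¹' A).indicator 1 x * f x - f x := fun n => by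
    filter_upwards [Lp.coeFn_sub (cutoff hA (a n) f) f, coeFn_cutoff hA (a n) f] with x h1 h2
    rw [h1, Pi.sub_apply, h2]
  have h1 : Tendsto (fun n => inner ℂ (cutoff hA (a n) f - f) (cutoff hA (a n) f - f)) atTop
      (𝓝 (∫ _ : E, (0 : ℂ))) := by
    simp only [L2.inner_def]
    refine tendsto_integral_of_dominated_convergence (fun x => ‖inner ℂ (f x) (f x)‖)
      (fun n => (L2.integrable_inner _ _).aestronglyMeasurable) (L2.integrable_inner f f).norm
      (fun n => ?_) ?_
    · filter_upwards [hx n] with x hx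
      rw [hx]
      by_cases hxA : x ∈ (fun x => x + a n) ⁻¹' A
      · simp [hxA]
      · simp [hxA]
    · filter_upwards [ae_all_iff.2 hx] with x hx
      refine tendsto_const_nhds.congr' ?_
      filter_upwards [ha x] with n hn
      rw [hx, Set.indicator_of_mem (show x ∈ (fun x => x + a n) ⁻¹' A from hn)]
      simp
  rw [integral_zero] at h1
  have h2 := h1.norm
  simp only [norm_zero, inner_self_eq_norm_sq_to_K, norm_pow] at h2
  rw [tendsto_iff_norm_sub_tendsto_zero]
  have h3 := h2.sqrt
  simpa using h3

theorem commute_of_compression {P : Set E} (hPconvex : Convex ℝ P)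
    (hPcone : ∀ x ∈ P, ∀ t : ℝ, 0 ≤ t → t • x ∈ P)
    (hPspan : ∀ v, ∃ x ∈ P, ∃ y ∈ P, v = x - y)
    (hA : IsClosed A) (hAzero : (0 : E) ∈ A) (hAmod : ∀ b ∈ A, ∀ p ∈ P, b + p ∈ A)
    {t r : Lp ℂ 2 (volume : Measure E) →L[ℂ] Lp ℂ 2 (volume : Measure E)}
    (ht : ∀ x ∈ P, ∀ f, t (translateLp x (cutoff hA 0 f)) = translateLp x (t f))
    (ht' : ∀ x ∈ P, ∀ f, t (translateLp (-x) f) = cutoff hA 0 (translateLp (-x) (t f)))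
    (hr : ∀ z, (fun b => b + z) '' A = A → ∀ f, r (translateLp z f) = translateLp z (r f))
    (hrA : ∀ f, r (cutoff hA 0 f) = r f) (hAr : ∀ f, cutoff hA 0 (r f) = r f)
    (f : Lp ℂ 2 (volume : Measure E)) : t (r f) = r (t f) := by
  obtain ⟨p, hp⟩ := hPconvex.interior_nonempty_of_forall_eq_sub hPspan
  have h0 : (0 : E) ∈ P := by simpa using hPcone p (interior_subset hp) 0 le_rfl
  have hPA : ∀ x ∈ P, x ∈ A := fun x hx => by simpa using hAmod 0 hAzero x hx
  let s : E → Lp ℂ 2 (volume : Measure E) →L[ℂ] Lp ℂ 2 (volume : Measure E) :=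
    fun a => translateLp (-a) ∘L t ∘L translateLp a
  have hs : ∀ a f, s a f = translateLp (-a) (t (translateLp a f)) := fun a f => rfl
  have hs₀ : ∀ f, s 0 f = t f := fun f => by rw [hs, neg_zero, translateLp_zero, translateLp_zero]
  have hsQ : ∀ a b, b - a ∈ P → ∀ f, s b (cutoff hA a f) = s a f := by
    intro a b hab f
    have e : translateLp b (cutoff hA a f) =
        translateLp (b - a) (cutoff hA 0 (translateLp a f)) := by
      rw [cutoff_translateLp, translateLp_translateLp, sub_add_cancel, zero_add]
    rw [hs, hs, e, ht _ hab, translateLp_translateLp]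
    congr 2
    abel
  have hQs : ∀ a b, b - a ∈ P → ∀ f, cutoff hA a (s b f) = s a f := by
    intro a b hab f
    have e : ∀ g, translateLp (-b) g = translateLp (-a) (translateLp (-(b - a)) g) := fun g => by
      rw [translateLp_translateLp]
      congr 2
      abel
    rw [hs, hs, e, cutoff_translateLp, add_neg_cancel, ← ht' _ hab, translateLp_translateLp]
    congr 4
    abel
  have hev : ∀ v x, ∀ᶠ n : ℕ in atTop, x + (n • p + v) ∈ A := fun v x => by
    filter_upwards [eventually_nsmul_add_mem hPcone hp (v + x)] with n hn
    rw [add_comm, add_assoc]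
    exact hPA _ hn
  have hlim : ∀ v f, Tendsto (fun n : ℕ => cutoff hA (n • p + v) f) atTop (𝓝 f) :=
    fun v f => tendsto_cutoff hA (hev v) f
  have hlim₀ : ∀ f, Tendsto (fun n : ℕ => cutoff hA (n • p) f) atTop (𝓝 f) := fun f => by
    simpa using hlim 0 f
  have hnorm : ∀ a f, ‖s a f‖ ≤ ‖t‖ * ‖f‖ := fun a f => by
    have h1 : ∀ a (f : Lp ℂ 2 (volume : Measure E)), ‖translateLp a f‖ = ‖f‖ := fun a f =>
      (Lp.compMeasurePreservingₗᵢ ℂ (fun x => x - a)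
        (measurePreserving_sub_right volume a)).norm_map f
    rw [hs, h1]
    exact (t.le_opNorm _).trans_eq (by rw [h1])
  have hcauchy : ∀ f, CauchySeq fun n : ℕ => s (n • p) f := fun f => by
    refine cauchySeq_of_le_tendsto_0' (fun n : ℕ => ‖t‖ * ‖f - cutoff hA (n • p) f‖)
      (fun n m hnm => ?_) ?_
    · rw [dist_comm, dist_eq_norm, ← hsQ (n • p) (m • p) _ f, ← map_sub]
      · exact hnorm _ _
      · rw [← Nat.sub_add_cancel hnm, add_smul, add_sub_cancel_right, ← Nat.cast_smul_eq_nsmul ℝ]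
        exact hPcone p (interior_subset hp) _ (Nat.cast_nonneg _)
    · have := ((tendsto_const_nhds.sub (hlim₀ f)).norm.const_mul ‖t‖ :
        Tendsto (fun n : ℕ => ‖t‖ * ‖f - cutoff hA (n • p) f‖) atTop (𝓝 (‖t‖ * ‖f - f‖)))
      simpa using this
  choose s' hs' using fun f => cauchySeq_tendsto_of_complete (hcauchy f)
  let T : Lp ℂ 2 (volume : Measure E) →L[ℂ] Lp ℂ 2 (volume : Measure E) :=
    continuousLinearMapOfTendsto (fun n : ℕ => s (n • p)) (tendsto_pi_nhds.2 hs')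
  have hT : ∀ f, Tendsto (fun n : ℕ => s (n • p) f) atTop (𝓝 (T f)) := hs'
  have hTQ : ∀ a f, T (cutoff hA a f) = s a f := fun a f => by
    refine tendsto_nhds_unique (hT _) (tendsto_const_nhds.congr' ?_)
    filter_upwards [eventually_nsmul_add_mem hPcone hp (-a)] with n hn
    exact (hsQ a _ (by rwa [sub_eq_add_neg]) f).symm
  have hQT : ∀ a f, cutoff hA a (T f) = s a f := fun a f => by
    refine tendsto_nhds_unique (((cutoff hA a).continuous.tendsto _).comp (hT f))
      (tendsto_const_nhds.congr' ?_)
    filter_upwards [eventually_nsmul_add_mem hPcone hp (-a)] with n hn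
    exact (hQs a _ (by rwa [sub_eq_add_neg]) f).symm
  have hTW : ∀ a f, T (translateLp a f) = translateLp a (T f) := fun a f => by
    refine tendsto_nhds_unique (hT _) ((((translateLp a).continuous.comp T.continuous).tendsto
      _).comp (hlim a f) |>.congr fun n => ?_)
    simp only [Function.comp_def, hTQ, hs, translateLp_translateLp]
    congr 2
    abel
  have hTr := commute_of_translation_invariant (G := {z | (fun b => b + z) '' A = A}) (t := T)
    (r := r) ?_ hTW ?_ hr f
  · rw [← hs₀, ← hTQ, hAr, hTr, ← hrA, hQT, hs₀]
  · intro z hz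
    simp only [Set.mem_ofPred_eq] at hz ⊢
    conv_lhs => rw [← hz]
    rw [Set.image_image]
    simp
  · intro b hb
    obtain ⟨D, hDc, hD⟩ := TopologicalSpace.exists_countable_dense E
    have : Countable D := hDc.to_subtype
    refine commutesMul_of_separating (ι := D)
      (h := fun q => ((fun x => x + (q : E)) ⁻¹' A).indicator 1) (fun q => ?_)
      (measurable_character b) (fun x => (norm_character b x).le) fun x y hxy => ?_
    · have e : (fun x => ((((fun x => x + (q : E)) ⁻¹' A).indicator (1 : E → ℝ) x : ℝ) : ℂ)) =
          ((fun x => x + (q : E)) ⁻¹' A).indicator 1 := by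
        funext x
        by_cases hx : x ∈ (fun x => x + (q : E)) ⁻¹' A
        · rw [Set.indicator_of_mem hx, Set.indicator_of_mem hx]
          simp
        · rw [Set.indicator_of_notMem hx, Set.indicator_of_notMem hx]
          simp
      rw [e]
      exact commutesMul_indicator_of_cutoff hA (q : E) fun f => (hTQ _ f).trans (hQT _ f).symm
    · have hz := hb (x - y) (image_add_eq_of_dense hPconvex h0 ⟨p, hp⟩ hA hAmod hD fun q hq => by
        have := hxy ⟨q, hq⟩
        rw [← Set.mem_preimage (f := fun x => x + q), ← Set.indicator_eq_one_iff_mem ℝ, this,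
          Set.indicator_eq_one_iff_mem, Set.mem_preimage])
      have := character_add b (x - y) y
      rwa [sub_add_cancel, hz, one_mul] at this

end Dilation

section Fibers

variable {E : Type*} [NormedAddCommGroup E] {A : Set E}

theorem sub_mem_iff_of_image_add_eq {z : E} (hz : (fun b => b + z) '' A = A) (y : E) :
    y - z ∈ A ↔ y ∈ A := by
  conv_rhs => rw [← hz]
  simp [sub_eq_add_neg]

variable [InnerProductSpace ℝ E] [MeasurableSpace E] [BorelSpace E] [FiniteDimensional ℝ E]
  {K : Type*} [NormedAddCommGroup K]

theorem Lp.ext_of_ae_mem (hA : IsClosed A) {F F' : Lp K 2 ((volume : Measure E).restrict A)}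
    (h : ∀ᵐ y, y ∈ A → F y = F' y) : F = F' :=
  Lp.ext ((ae_restrict_iff' hA.measurableSet).2 h)

theorem ae_comp_add {p : E → Prop} (h : ∀ᵐ y, p y) (a : E) : ∀ᵐ y, p (y + a) :=
  (measurePreserving_add_right volume a).quasiMeasurePreserving.ae h

theorem cutoff_zero_apply (hA : IsClosed A) (f : Lp ℂ 2 (volume : Measure E)) :
    cutoff hA 0 f =ᵐ[volume] A.indicator f := by
  filter_upwards [coeFn_cutoff hA 0 f] with y h1
  have : (fun x : E => x + 0) ⁻¹' A = A := by simp
  rw [h1, this]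
  by_cases hy : y ∈ A <;> simp [hy]

variable [InnerProductSpace ℂ K]

/-- The operator `f ↦ f|_A • k` from `L²(E; ℂ)` to `L²(A; K)`. -/
def restrictSmul (A : Set E) (k : K) :
    Lp ℂ 2 (volume : Measure E) →L[ℂ] Lp K 2 ((volume : Measure E).restrict A) :=
  (ContinuousLinearMap.toSpanSingleton ℂ k).compLpL 2 (volume.restrict A) ∘L
    LpToLpRestrictCLM E ℂ ℂ volume 2 A

theorem coeFn_restrictSmul (hA : IsClosed A) (k : K) (f : Lp ℂ 2 (volume : Measure E)) :
    ∀ᵐ y, y ∈ A → restrictSmul A k f y = f y • k := by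
  rw [← ae_restrict_iff' hA.measurableSet]
  filter_upwards [(ContinuousLinearMap.toSpanSingleton ℂ k).coeFn_compLpL
    (LpToLpRestrictCLM E ℂ ℂ volume 2 A f), LpToLpRestrictCLM_coeFn ℂ A f] with y h1 h2
  rw [restrictSmul, ContinuousLinearMap.comp_apply, h1, h2,
    ContinuousLinearMap.toSpanSingleton_apply]

theorem restrictSmul_cutoff (hA : IsClosed A) (k : K) (f : Lp ℂ 2 (volume : Measure E)) :
    restrictSmul A k (cutoff hA 0 f) = restrictSmul A k f := by
  apply Lp.ext_of_ae_mem hA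
  filter_upwards [coeFn_restrictSmul hA k f, coeFn_restrictSmul hA k (cutoff hA 0 f),
    cutoff_zero_apply hA f] with y h1 h2 h3 hy
  rw [h1 hy, h2 hy, h3, Set.indicator_of_mem hy]

variable {x : E} {v : Lp K 2 ((volume : Measure E).restrict A) →L[ℂ] Lp K 2 (volume.restrict A)}
  {z : E} {u : Lp K 2 ((volume : Measure E).restrict A) →L[ℂ] Lp K 2 (volume.restrict A)}
  {S : K →L[ℂ] K}
  {m : Lp K 2 ((volume : Measure E).restrict A) →L[ℂ] Lp K 2 (volume.restrict A)}

theorem shift_restrictSmul (hA : IsClosed A)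
    (hv : ∀ F, v F =ᵐ[volume.restrict A] fun y => A.indicator F (y - x)) (k : K)
    (f : Lp ℂ 2 (volume : Measure E)) :
    v (restrictSmul A k f) = restrictSmul A k (translateLp x (cutoff hA 0 f)) := by
  apply Lp.ext_of_ae_mem hA
  filter_upwards [(ae_restrict_iff' hA.measurableSet).1 (hv (restrictSmul A k f)),
    ae_comp_sub (coeFn_restrictSmul hA k f) x,
    coeFn_restrictSmul hA k (translateLp x (cutoff hA 0 f)),
    coeFn_translateLp x (cutoff hA 0 f), ae_comp_sub (cutoff_zero_apply hA f) x]
    with y h1 h2 h3 h4 h5 hy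
  rw [h1 hy, h3 hy, h4, h5]
  by_cases hyx : y - x ∈ A
  · rw [Set.indicator_of_mem hyx, Set.indicator_of_mem hyx, h2 hyx]
  · rw [Set.indicator_of_notMem hyx, Set.indicator_of_notMem hyx, zero_smul]

theorem translation_restrictSmul (hA : IsClosed A) (hz : (fun b => b + z) '' A = A)
    (hu : ∀ F, u F =ᵐ[volume.restrict A] fun y => F (y - z)) (k : K)
    (f : Lp ℂ 2 (volume : Measure E)) :
    u (restrictSmul A k f) = restrictSmul A k (translateLp z f) := by
  apply Lp.ext_of_ae_mem hA
  filter_upwards [(ae_restrict_iff' hA.measurableSet).1 (hu (restrictSmul A k f)),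
    ae_comp_sub (coeFn_restrictSmul hA k f) z, coeFn_restrictSmul hA k (translateLp z f),
    coeFn_translateLp z f] with y h1 h2 h3 h4 hy
  rw [h1 hy, h2 ((sub_mem_iff_of_image_add_eq hz y).2 hy), h3 hy, h4]

theorem shift_translation_comm (hA : IsClosed A)
    (hv : ∀ F, v F =ᵐ[volume.restrict A] fun y => A.indicator F (y - x))
    (hz : (fun b => b + z) '' A = A) (hu : ∀ F, u F =ᵐ[volume.restrict A] fun y => F (y - z)) :
    u * v = v * u := by
  ext1 F
  apply Lp.ext_of_ae_mem hA
  have hu' := fun F => (ae_restrict_iff' hA.measurableSet).1 (hu F)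
  have hv' := fun F => (ae_restrict_iff' hA.measurableSet).1 (hv F)
  filter_upwards [hu' (v F), hv' (u F), ae_comp_sub (hu' F) x, ae_comp_sub (hv' F) z]
    with y h1 h2 h3 h4 hy
  rw [mul_apply_eq_comp, mul_apply_eq_comp, h1 hy, h2 hy,
    h4 ((sub_mem_iff_of_image_add_eq hz y).2 hy), sub_right_comm]
  by_cases hyx : y - x ∈ A
  · rw [Set.indicator_of_mem hyx, Set.indicator_of_mem
      ((sub_mem_iff_of_image_add_eq hz _).2 hyx), h3 hyx]
  · rw [Set.indicator_of_notMem hyx,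
      Set.indicator_of_notMem fun h => hyx ((sub_mem_iff_of_image_add_eq hz _).1 h)]

theorem shift_fiberwise_comm (hA : IsClosed A)
    (hv : ∀ F, v F =ᵐ[volume.restrict A] fun y => A.indicator F (y - x))
    (hm : ∀ F, m F =ᵐ[volume.restrict A] fun y => S (F y)) : m * v = v * m := by
  ext1 F
  apply Lp.ext_of_ae_mem hA
  have hm' := fun F => (ae_restrict_iff' hA.measurableSet).1 (hm F)
  have hv' := fun F => (ae_restrict_iff' hA.measurableSet).1 (hv F)
  filter_upwards [hm' (v F), hv' (m F), ae_comp_sub (hm' F) x, hv' F] with y h1 h2 h3 h4 hy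
  rw [mul_apply_eq_comp, mul_apply_eq_comp, h1 hy, h2 hy, h4 hy]
  by_cases hyx : y - x ∈ A
  · rw [Set.indicator_of_mem hyx, Set.indicator_of_mem hyx, h3 hyx]
  · rw [Set.indicator_of_notMem hyx, Set.indicator_of_notMem hyx, map_zero]

variable [CompleteSpace K]

open ContinuousLinearMap (adjoint)

theorem coeFn_adjoint_restrictSmul (hA : IsClosed A) (k : K)
    (F : Lp K 2 ((volume : Measure E).restrict A)) :
    adjoint (restrictSmul A k) F =ᵐ[volume] A.indicator fun y => inner ℂ k (F y) := by
  have hmem : MemLp (A.indicator fun y => inner ℂ k (F y)) 2 volume :=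
    (memLp_indicator_iff_restrict hA.measurableSet).2 ((Lp.memLp F).const_inner k)
  have key : adjoint (restrictSmul A k) F = hmem.toLp _ := by
    refine ext_inner_left ℂ fun f => ?_
    rw [ContinuousLinearMap.adjoint_inner_right, L2.inner_def, L2.inner_def,
      ← integral_indicator hA.measurableSet]
    refine integral_congr_ae ?_
    filter_upwards [hmem.coeFn_toLp, coeFn_restrictSmul hA k f] with y h1 h2
    rw [h1]
    by_cases hy : y ∈ A
    · rw [Set.indicator_of_mem hy, Set.indicator_of_mem hy, h2 hy, inner_smul_left,
        RCLike.inner_apply, mul_comm]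
    · rw [Set.indicator_of_notMem hy, Set.indicator_of_notMem hy, inner_zero_right]
  rw [key]
  exact hmem.coeFn_toLp

theorem eq_zero_of_adjoint_restrictSmul_eq_zero [TopologicalSpace.SeparableSpace K]
    (hA : IsClosed A) {F : Lp K 2 ((volume : Measure E).restrict A)}
    (h : ∀ k : K, adjoint (restrictSmul A k) F = 0) : F = 0 := by
  have : SecondCountableTopology K := UniformSpace.secondCountable_of_separable K
  rw [Lp.eq_zero_iff_ae_eq_zero]
  refine ae_eq_zero_of_forall_inner (𝕜 := ℂ) fun k => (ae_restrict_iff' hA.measurableSet).2 ?_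
  filter_upwards [coeFn_adjoint_restrictSmul hA k F, Lp.coeFn_zero ℂ 2 (volume : Measure E)]
    with y h1 h2 hy
  rw [h k, h2, Set.indicator_of_mem hy] at h1
  exact h1.symm

theorem cutoff_adjoint_restrictSmul (hA : IsClosed A) (k : K)
    (F : Lp K 2 ((volume : Measure E).restrict A)) :
    cutoff hA 0 (adjoint (restrictSmul A k) F) = adjoint (restrictSmul A k) F := by
  apply Lp.ext
  filter_upwards [coeFn_adjoint_restrictSmul hA k F,
    cutoff_zero_apply hA (adjoint (restrictSmul A k) F)] with y h1 h2
  rw [h2]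
  by_cases hy : y ∈ A
  · rw [Set.indicator_of_mem hy]
  · rw [Set.indicator_of_notMem hy, h1, Set.indicator_of_notMem hy]

theorem adjoint_restrictSmul_restrictSmul (hA : IsClosed A) {e : K} (he : ‖e‖ = 1)
    (f : Lp ℂ 2 (volume : Measure E)) :
    adjoint (restrictSmul A e) (restrictSmul A e f) = cutoff hA 0 f := by
  apply Lp.ext
  filter_upwards [coeFn_adjoint_restrictSmul hA e (restrictSmul A e f), coeFn_restrictSmul hA e f,
    cutoff_zero_apply hA f] with y h1 h2 h3
  rw [h1, h3]
  by_cases hy : y ∈ A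
  · rw [Set.indicator_of_mem hy, Set.indicator_of_mem hy, h2 hy, inner_smul_right,
      inner_self_eq_norm_sq_to_K, he]
    simp
  · rw [Set.indicator_of_notMem hy, Set.indicator_of_notMem hy]

theorem apply_rankOne_eq (hA : IsClosed A) (e k : K)
    {m : Lp K 2 ((volume : Measure E).restrict A) →L[ℂ] Lp K 2 (volume.restrict A)}
    (hm : ∀ F, m F =ᵐ[volume.restrict A] fun y => (innerSL ℂ e).smulRight k (F y))
    (F : Lp K 2 ((volume : Measure E).restrict A)) :
    m F = restrictSmul A k (adjoint (restrictSmul A e) F) := by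
  apply Lp.ext_of_ae_mem hA
  filter_upwards [(ae_restrict_iff' hA.measurableSet).1 (hm F), coeFn_adjoint_restrictSmul hA e F,
    coeFn_restrictSmul hA k (adjoint (restrictSmul A e) F)] with y h1 h2 h3 hy
  rw [h1 hy, h3 hy, h2, Set.indicator_of_mem hy]
  rfl

/-- The adjoint of the shift by `x` is the truncated shift by `-x`. -/
theorem coeFn_adjoint_shift (hA : IsClosed A) (hx : ∀ b ∈ A, b + x ∈ A)
    (hv : ∀ F, v F =ᵐ[volume.restrict A] fun y => A.indicator F (y - x))
    (F : Lp K 2 ((volume : Measure E).restrict A)) :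
    ∀ᵐ y, y ∈ A → adjoint v F y = F (y + x) := by
  have hmap : (volume.restrict A).map (fun y => y + x) ≤ volume.restrict A := by
    rw [((measurePreserving_add_right volume x).restrict_image_emb
      (measurableEmbedding_addRight x) A).map_eq]
    refine Measure.restrict_mono ?_ le_rfl
    rintro _ ⟨b, hb, rfl⟩
    exact hx b hb
  have hmem : MemLp (fun y => F (y + x)) 2 (volume.restrict A) :=
    ((measurableEmbedding_addRight x).memLp_map_measure_iff).1 ((Lp.memLp F).mono_measure hmap)
  have key : adjoint v F = hmem.toLp _ := by
    refine ext_inner_left ℂ fun f => ?_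
    rw [ContinuousLinearMap.adjoint_inner_right, L2.inner_def, L2.inner_def,
      ← integral_indicator hA.measurableSet, ← integral_indicator hA.measurableSet,
      ← integral_add_right_eq_self _ x]
    refine integral_congr_ae ?_
    filter_upwards [(ae_restrict_iff' hA.measurableSet).1 hmem.coeFn_toLp,
      (measurePreserving_add_right volume x).quasiMeasurePreserving.ae
        ((ae_restrict_iff' hA.measurableSet).1 (hv f))] with y h1 h2
    by_cases hy : y ∈ A
    · rw [Set.indicator_of_mem hy, Set.indicator_of_mem (hx y hy), h1 hy, h2 (hx y hy),
        add_sub_cancel_right, Set.indicator_of_mem hy]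
    · rw [Set.indicator_of_notMem hy]
      by_cases hy' : y + x ∈ A
      · rw [Set.indicator_of_mem hy', h2 hy', add_sub_cancel_right, Set.indicator_of_notMem hy,
          inner_zero_left]
      · rw [Set.indicator_of_notMem hy']
  rw [key]
  exact (ae_restrict_iff' hA.measurableSet).1 hmem.coeFn_toLp

theorem adjoint_shift_restrictSmul (hA : IsClosed A) (hx : ∀ b ∈ A, b + x ∈ A)
    (hv : ∀ F, v F =ᵐ[volume.restrict A] fun y => A.indicator F (y - x)) (k : K)
    (f : Lp ℂ 2 (volume : Measure E)) :
    adjoint v (restrictSmul A k f) = restrictSmul A k (translateLp (-x) f) := by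
  apply Lp.ext_of_ae_mem hA
  filter_upwards [coeFn_adjoint_shift hA hx hv (restrictSmul A k f),
    ae_comp_add (coeFn_restrictSmul hA k f) x, coeFn_restrictSmul hA k (translateLp (-x) f),
    coeFn_translateLp (-x) f] with y h1 h2 h3 h4 hy
  rw [h1 hy, h2 (hx y hy), h3 hy, h4, sub_neg_eq_add]

theorem adjoint_restrictSmul_shift (hA : IsClosed A) (hx : ∀ b ∈ A, b + x ∈ A)
    (hv : ∀ F, v F =ᵐ[volume.restrict A] fun y => A.indicator F (y - x)) (k : K)
    (F : Lp K 2 ((volume : Measure E).restrict A)) :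
    adjoint (restrictSmul A k) (v F) = translateLp x (adjoint (restrictSmul A k) F) := by
  apply Lp.ext
  filter_upwards [coeFn_adjoint_restrictSmul hA k (v F),
    (ae_restrict_iff' hA.measurableSet).1 (hv F),
    coeFn_translateLp x (adjoint (restrictSmul A k) F),
    ae_comp_sub (coeFn_adjoint_restrictSmul hA k F) x] with y h1 h2 h3 h4
  rw [h1, h3, h4]
  by_cases hyx : y - x ∈ A
  · have hy : y ∈ A := by simpa using hx _ hyx
    rw [Set.indicator_of_mem hyx, Set.indicator_of_mem hy, h2 hy, Set.indicator_of_mem hyx]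
  · rw [Set.indicator_of_notMem hyx]
    by_cases hy : y ∈ A
    · rw [Set.indicator_of_mem hy, h2 hy, Set.indicator_of_notMem hyx, inner_zero_right]
    · rw [Set.indicator_of_notMem hy]

theorem adjoint_restrictSmul_adjoint_shift (hA : IsClosed A) (hx : ∀ b ∈ A, b + x ∈ A)
    (hv : ∀ F, v F =ᵐ[volume.restrict A] fun y => A.indicator F (y - x)) (k : K)
    (F : Lp K 2 ((volume : Measure E).restrict A)) :
    adjoint (restrictSmul A k) (adjoint v F) =
      cutoff hA 0 (translateLp (-x) (adjoint (restrictSmul A k) F)) := by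
  apply Lp.ext
  filter_upwards [coeFn_adjoint_restrictSmul hA k (adjoint v F), coeFn_adjoint_shift hA hx hv F,
    cutoff_zero_apply hA (translateLp (-x) (adjoint (restrictSmul A k) F)),
    coeFn_translateLp (-x) (adjoint (restrictSmul A k) F),
    ae_comp_sub (coeFn_adjoint_restrictSmul hA k F) (-x)] with y h1 h2 h3 h4 h5
  rw [h1, h3]
  by_cases hy : y ∈ A
  · rw [Set.indicator_of_mem hy, Set.indicator_of_mem hy, h4, h5, h2 hy, sub_neg_eq_add,
      Set.indicator_of_mem (hx y hy)]
  · rw [Set.indicator_of_notMem hy, Set.indicator_of_notMem hy]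

theorem adjoint_restrictSmul_translation (hA : IsClosed A) (hz : (fun b => b + z) '' A = A)
    (hu : ∀ F, u F =ᵐ[volume.restrict A] fun y => F (y - z)) (k : K)
    (F : Lp K 2 ((volume : Measure E).restrict A)) :
    adjoint (restrictSmul A k) (u F) = translateLp z (adjoint (restrictSmul A k) F) := by
  apply Lp.ext
  filter_upwards [coeFn_adjoint_restrictSmul hA k (u F),
    (ae_restrict_iff' hA.measurableSet).1 (hu F),
    coeFn_translateLp z (adjoint (restrictSmul A k) F),
    ae_comp_sub (coeFn_adjoint_restrictSmul hA k F) z] with y h1 h2 h3 h4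
  rw [h1, h3, h4]
  by_cases hy : y ∈ A
  · rw [Set.indicator_of_mem hy, Set.indicator_of_mem ((sub_mem_iff_of_image_add_eq hz y).2 hy),
      h2 hy]
  · rw [Set.indicator_of_notMem hy,
      Set.indicator_of_notMem fun h => hy ((sub_mem_iff_of_image_add_eq hz y).1 h)]

theorem adjoint_shift_translation_comm (hA : IsClosed A) (hx : ∀ b ∈ A, b + x ∈ A)
    (hv : ∀ F, v F =ᵐ[volume.restrict A] fun y => A.indicator F (y - x))
    (hz : (fun b => b + z) '' A = A) (hu : ∀ F, u F =ᵐ[volume.restrict A] fun y => F (y - z)) :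
    u * adjoint v = adjoint v * u := by
  ext1 F
  apply Lp.ext_of_ae_mem hA
  have hu' := fun F => (ae_restrict_iff' hA.measurableSet).1 (hu F)
  have hv' := coeFn_adjoint_shift hA hx hv
  filter_upwards [hu' (adjoint v F), hv' (u F), ae_comp_add (hu' F) x, ae_comp_sub (hv' F) z]
    with y h1 h2 h3 h4 hy
  rw [mul_apply_eq_comp, mul_apply_eq_comp, h1 hy, h2 hy,
    h4 ((sub_mem_iff_of_image_add_eq hz y).2 hy), h3 (hx y hy), sub_add_eq_add_sub]

theorem adjoint_shift_fiberwise_comm (hA : IsClosed A) (hx : ∀ b ∈ A, b + x ∈ A)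
    (hv : ∀ F, v F =ᵐ[volume.restrict A] fun y => A.indicator F (y - x))
    (hm : ∀ F, m F =ᵐ[volume.restrict A] fun y => S (F y)) :
    m * adjoint v = adjoint v * m := by
  ext1 F
  apply Lp.ext_of_ae_mem hA
  have hm' := fun F => (ae_restrict_iff' hA.measurableSet).1 (hm F)
  have hv' := coeFn_adjoint_shift hA hx hv
  filter_upwards [hm' (adjoint v F), hv' (m F), ae_comp_add (hm' F) x, hv' F]
    with y h1 h2 h3 h4 hy
  rw [mul_apply_eq_comp, mul_apply_eq_comp, h1 hy, h2 hy, h4 hy,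
    h3 (hx y hy)]

/-- An operator on `L²(A; K)` commuting with the shifts and their adjoints commutes with every
operator commuting with the translations by the isotropy group and the fiberwise operators. -/
theorem mul_comm_of_commutes_shift [TopologicalSpace.SeparableSpace K] {P : Set E}
    (hPconvex : Convex ℝ P) (hPcone : ∀ x ∈ P, ∀ t : ℝ, 0 ≤ t → t • x ∈ P)
    (hPspan : ∀ v, ∃ x ∈ P, ∃ y ∈ P, v = x - y)
    (hA : IsClosed A) (hAzero : (0 : E) ∈ A) (hAmod : ∀ b ∈ A, ∀ p ∈ P, b + p ∈ A)
    {V U : E → Lp K 2 ((volume : Measure E).restrict A) →L[ℂ] Lp K 2 (volume.restrict A)}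
    (hV : ∀ x ∈ P, ∀ F, V x F =ᵐ[volume.restrict A] fun y => A.indicator F (y - x))
    (hU : ∀ z, (fun b => b + z) '' A = A → ∀ F, U z F =ᵐ[volume.restrict A] fun y => F (y - z))
    {M : (K →L[ℂ] K) → Lp K 2 ((volume : Measure E).restrict A) →L[ℂ] Lp K 2 (volume.restrict A)}
    (hM : ∀ S F, M S F =ᵐ[volume.restrict A] fun y => S (F y))
    {T R : Lp K 2 ((volume : Measure E).restrict A) →L[ℂ] Lp K 2 (volume.restrict A)}
    (hT : ∀ x ∈ P, V x * T = T * V x) (hT' : ∀ x ∈ P, adjoint (V x) * T = T * adjoint (V x))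
    (hR : ∀ z, (fun b => b + z) '' A = A → U z * R = R * U z) (hR' : ∀ S, M S * R = R * M S) :
    R * T = T * R := by
  rcases subsingleton_or_nontrivial K with hK | hK
  · ext1 F
    exact Lp.ext (Eventually.of_forall fun y => Subsingleton.elim _ _)
  obtain ⟨k₀, hk₀⟩ := exists_ne (0 : K)
  obtain ⟨e, he⟩ : ∃ e : K, ‖e‖ = 1 := ⟨_, norm_smul_inv_norm (𝕜 := ℂ) hk₀⟩
  have hx : ∀ x ∈ P, ∀ b ∈ A, b + x ∈ A := fun x hx b hb => hAmod b hb x hx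
  have hTV := fun x hx F => congrArg (fun S => S F) (hT x hx)
  have hTV' := fun x hx F => congrArg (fun S => S F) (hT' x hx)
  have hRU := fun z hz F => congrArg (fun S => S F) (hR z hz)
  have hRM := fun S F => congrArg (fun S => S F) (hR' S)
  simp only [mul_apply_eq_comp] at hTV hTV' hRU hRM
  have hrank : ∀ e k F, M ((innerSL ℂ e).smulRight k) F =
      restrictSmul A k (adjoint (restrictSmul A e) F) :=
    fun e k => apply_rankOne_eq hA e k (hM _)
  let r : Lp ℂ 2 (volume : Measure E) →L[ℂ] Lp ℂ 2 (volume : Measure E) :=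
    adjoint (restrictSmul A e) ∘L R ∘L restrictSmul A e
  have hr : ∀ f, r f = adjoint (restrictSmul A e) (R (restrictSmul A e f)) := fun f => rfl
  have hRj : ∀ k f, R (restrictSmul A k f) = restrictSmul A k (r f) := fun k f => by
    rw [hr, ← hrank, hRM, hrank, adjoint_restrictSmul_restrictSmul hA he, restrictSmul_cutoff]
  have hjR : ∀ k F, adjoint (restrictSmul A k) (R F) = r (adjoint (restrictSmul A k) F) :=
    fun k F => by
      rw [hr, ← hrank, ← hRM, hrank, adjoint_restrictSmul_restrictSmul hA he,
        cutoff_adjoint_restrictSmul]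
  have hcomm : ∀ k l f, adjoint (restrictSmul A k) (T (R (restrictSmul A l f))) =
      adjoint (restrictSmul A k) (R (T (restrictSmul A l f))) := fun k l f => by
    rw [hRj, hjR]
    refine commute_of_compression (r := r)
      (t := adjoint (restrictSmul A k) ∘L T ∘L restrictSmul A l) hPconvex hPcone hPspan hA hAzero
      hAmod (fun x hxP f => ?_) (fun x hxP f => ?_) (fun z hz f => ?_) (fun f => ?_)
      (fun f => ?_) f
    · simp only [ContinuousLinearMap.comp_apply]
      rw [← shift_restrictSmul hA (hV x hxP), ← hTV x hxP,
        adjoint_restrictSmul_shift hA (hx x hxP) (hV x hxP)]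
    · simp only [ContinuousLinearMap.comp_apply]
      rw [← adjoint_shift_restrictSmul hA (hx x hxP) (hV x hxP), ← hTV' x hxP,
        adjoint_restrictSmul_adjoint_shift hA (hx x hxP) (hV x hxP)]
    · rw [hr, hr, ← translation_restrictSmul hA hz (hU z hz), ← hRU z hz,
        adjoint_restrictSmul_translation hA hz (hU z hz)]
    · rw [hr, hr, restrictSmul_cutoff]
    · rw [hr, cutoff_adjoint_restrictSmul]
  have hzero : ∀ l f, (R * T - T * R) (restrictSmul A l f) = 0 := fun l f => by
    refine eq_zero_of_adjoint_restrictSmul_eq_zero hA fun k => ?_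
    rw [sub_apply, mul_apply_eq_comp,
      mul_apply_eq_comp, map_sub, hcomm, sub_self]
  have hadj : adjoint (R * T - T * R) = 0 := by
    ext1 F
    refine eq_zero_of_adjoint_restrictSmul_eq_zero hA fun l => ext_inner_left ℂ fun f => ?_
    rw [ContinuousLinearMap.adjoint_inner_right, ContinuousLinearMap.adjoint_inner_right, hzero,
      inner_zero_left, inner_zero_right]
  rw [← sub_eq_zero, ← ContinuousLinearMap.adjoint_adjoint (R * T - T * R), hadj, map_zero]

end Fibers

end

open MeasureTheory

/-- For `d ≥ 2`, a `P`-module `A` and a separable Hilbert space `K`, let `V` be the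
isometric representation of `P` on `L²(A; K)`, let `U_z` (`z ∈ G_A`) be the
translation unitaries and `M_S` (`S ∈ B(K)`) the fiberwise operators. Then the
commutant of the von Neumann algebra generated by `{V_x : x ∈ P}` equals the von
Neumann algebra generated by `{U_z : z ∈ G_A} ∪ {M_S : S ∈ B(K)}`. -/
theorem commutant_multiplicity_k
    (d : ℕ) (hd : 2 ≤ d) (P A : Set (EuclideanSpace ℝ (Fin d)))
    (hPclosed : IsClosed P) (hPconvex : Convex ℝ P)
    (hPcone : ∀ x ∈ P, ∀ t : ℝ, 0 ≤ t → t • x ∈ P)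
    (hPspan : ∀ v : EuclideanSpace ℝ (Fin d), ∃ x ∈ P, ∃ y ∈ P, v = x - y)
    (hPpointed : P ∩ (-P) = {0})
    (hAclosed : IsClosed A) (hAproper : A ≠ Set.univ)
    (hAzero : (0 : EuclideanSpace ℝ (Fin d)) ∈ A)
    (hAmod : ∀ b ∈ A, ∀ p ∈ P, b + p ∈ A)
    (K : Type*) [NormedAddCommGroup K] [InnerProductSpace ℂ K] [CompleteSpace K]
    [TopologicalSpace.SeparableSpace K]
    (V : EuclideanSpace ℝ (Fin d) →
      (Lp K 2 (volume.restrict A) →L[ℂ] Lp K 2 (volume.restrict A)))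
    (hV : ∀ x ∈ P, ∀ f : Lp K 2 (volume.restrict A),
      ⇑(V x f) =ᵐ[volume.restrict A] fun y => A.indicator (⇑f) (y - x))
    (U : EuclideanSpace ℝ (Fin d) →
      (Lp K 2 (volume.restrict A) →L[ℂ] Lp K 2 (volume.restrict A)))
    (hU : ∀ z : EuclideanSpace ℝ (Fin d), (fun b => b + z) '' A = A →
      ∀ f : Lp K 2 (volume.restrict A),
        ⇑(U z f) =ᵐ[volume.restrict A] fun y => f (y - z))
    (M : (K →L[ℂ] K) → (Lp K 2 (volume.restrict A) →L[ℂ] Lp K 2 (volume.restrict A)))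
    (hM : ∀ S : K →L[ℂ] K, ∀ f : Lp K 2 (volume.restrict A),
      ⇑(M S f) =ᵐ[volume.restrict A] fun y => S (f y)) :
    Set.centralizer
        ({T | ∃ x ∈ P, T = V x} ∪ {T | ∃ x ∈ P, T = ContinuousLinearMap.adjoint (V x)}) =
      Set.centralizer (Set.centralizer
        ({T | ∃ z : EuclideanSpace ℝ (Fin d), (fun b => b + z) '' A = A ∧ T = U z} ∪
          {T | ∃ S : K →L[ℂ] K, T = M S})) := by
  have hx : ∀ x ∈ P, ∀ b ∈ A, b + x ∈ A := fun x hx b hb => hAmod b hb x hx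
  refine Set.Subset.antisymm (fun T hT R hR => ?_) (Set.centralizer_subset ?_)
  · refine mul_comm_of_commutes_shift hPconvex hPcone hPspan hAclosed hAzero hAmod hV hU hM
      (fun x hxP => hT _ (Or.inl ⟨x, hxP, rfl⟩)) (fun x hxP => hT _ (Or.inr ⟨x, hxP, rfl⟩))
      (fun z hz => hR _ (Or.inl ⟨z, hz, rfl⟩)) (fun S => hR _ (Or.inr ⟨S, rfl⟩))
  · rintro _ (⟨x, hxP, rfl⟩ | ⟨x, hxP, rfl⟩) _ (⟨z, hz, rfl⟩ | ⟨S, rfl⟩)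
    · exact shift_translation_comm hAclosed (hV x hxP) hz (hU z hz)
    · exact shift_fiberwise_comm hAclosed (hV x hxP) (hM S)
    · exact adjoint_shift_translation_comm hAclosed (hx x hxP) (hV x hxP) hz (hU z hz)
    · exact adjoint_shift_fiberwise_comm hAclosed (hx x hxP) (hV x hxP) (hM S)
end

section
/- Let n ≥ 2, let H be a complex Hilbert space whose dimension is strictly less than n, and let ρ be a group homomorphism from the unitary group U(n) of ℂ^n into the group of unitary operators on H which is strongly continuous, i.e. for each v ∈ H the map U(n) ∋ U ↦ ρ(U)v ∈ H is continuous (U(n) carrying its norm topology). Then ρ(U) = 1_H for every U ∈ SU(n), where SU(n) = {U ∈ U(n) : det U = 1}. -/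
open Module Module.End

theorem Nat.le_choose_of_pos_of_lt {n k : ℕ} (hk : 0 < k) (hkn : k < n) : n ≤ n.choose k := by
  induction n generalizing k with
  | zero => omega
  | succ n ih =>
    obtain ⟨k, rfl⟩ := Nat.exists_eq_succ_of_ne_zero hk.ne'
    rw [Nat.choose_succ_succ]
    rcases Nat.lt_succ_iff_lt_or_eq.mp hkn with h | h
    · have := ih (Nat.succ_pos k) h
      have := Nat.choose_pos (n := n) (k := k) (by omega)
      simp only [Nat.succ_eq_add_one] at *
      omega
    · subst h
      simp [Nat.choose_succ_self_right]

/-- A set of functions on a finite type that is stable under permutations of the variables and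
contains a nonconstant function has at least as many elements as the type. -/
theorem Fintype.card_le_card_of_perm_stable {ι α : Type*} [Fintype ι] (S : Finset (ι → α))
    (hS : ∀ χ ∈ S, ∀ σ : Equiv.Perm ι, χ ∘ σ ∈ S) {χ : ι → α} (hχ : χ ∈ S) {i j : ι}
    (hij : χ i ≠ χ j) : Fintype.card ι ≤ S.card := by
  classical
  let level : (ι → α) → Finset ι := fun ψ => Finset.univ.filter fun k => ψ k = χ i
  have hpos : 0 < (level χ).card := Finset.card_pos.mpr ⟨i, by simp [level]⟩
  have hlt : (level χ).card < Fintype.card ι :=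
    Finset.card_lt_univ_of_notMem (x := j) (by simpa [level] using hij.symm)
  have hsub : Finset.powersetCard (level χ).card Finset.univ ⊆ S.image level := by
    intro T hT
    have hcard : T.card = (level χ).card := (Finset.mem_powersetCard.mp hT).2
    let e : {x // x ∈ T} ≃ {x // x ∈ level χ} := Finset.equivOfCardEq hcard
    refine Finset.mem_image.mpr ⟨χ ∘ e.extendSubtype, hS χ hχ _, ?_⟩
    ext k
    have hmem : e.extendSubtype k ∈ level χ ↔ k ∈ T :=
      ⟨fun h => by_contra fun hk => e.extendSubtype_not_mem k hk h, e.extendSubtype_mem k⟩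
    simpa [level] using hmem
  calc Fintype.card ι ≤ (Fintype.card ι).choose (level χ).card :=
        Nat.le_choose_of_pos_of_lt hpos hlt
    _ = (Finset.powersetCard (level χ).card (Finset.univ : Finset ι)).card := by
        rw [Finset.card_powersetCard, Finset.card_univ]
    _ ≤ (S.image level).card := Finset.card_le_card hsub
    _ ≤ S.card := Finset.card_image_le

/-- A commuting family of diagonalizable endomorphisms, indexed by a type with more elements than
the dimension of the space and whose members are permuted arbitrarily by conjugation,
is constant. -/
theorem Module.End.eq_of_commute_of_forall_perm_conj {ι K M : Type*} [Fintype ι] [Field K]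
    [AddCommGroup M] [Module K M] [FiniteDimensional K M] (f : ι → End K M)
    (hcomm : ∀ i j, Commute (f i) (f j)) (hss : ∀ i, (f i).IsFinitelySemisimple)
    (htop : ∀ i, ⨆ μ, (f i).maxGenEigenspace μ = ⊤)
    (hperm : ∀ σ : Equiv.Perm ι, ∃ Q : M ≃ₗ[K] M, ∀ i x, Q (f (σ i) x) = f i (Q x))
    (hcard : finrank K M < Fintype.card ι) (i j : ι) : f i = f j := by
  classical
  let W : (ι → K) → Submodule K M := fun χ => ⨅ i, (f i).maxGenEigenspace (χ i)
  have hW : ∀ χ x, x ∈ W χ ↔ ∀ i, f i x = χ i • x := fun χ x => by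
    simp [W, (hss _).maxGenEigenspace_eq_eigenspace]
  have hindep : iSupIndep W := independent_iInf_maxGenEigenspace_of_forall_mapsTo f
    fun i j => mapsTo_maxGenEigenspace_of_comm (hcomm j i)
  have hsup : ⨆ χ, W χ = ⊤ :=
    iSup_iInf_maxGenEigenspace_eq_top_of_iSup_maxGenEigenspace_eq_top_of_commute f
      (fun i j _ => hcomm i j) htop
  have : Fintype {χ // W χ ≠ ⊥} := hindep.fintypeNeBotOfFiniteDimensional
  let S : Finset (ι → K) := Finset.univ.map (Function.Embedding.subtype fun χ => W χ ≠ ⊥)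
  have hS : ∀ χ, χ ∈ S ↔ W χ ≠ ⊥ := fun χ => by simp [S]
  have hScard : S.card ≤ finrank K M := by
    rw [Finset.card_map, Finset.card_univ]
    exact hindep.subtype_ne_bot_le_finrank
  have hstable : ∀ χ ∈ S, ∀ σ : Equiv.Perm ι, χ ∘ σ ∈ S := by
    intro χ hχ σ
    rw [hS, Submodule.ne_bot_iff] at hχ ⊢
    obtain ⟨x, hx, hx0⟩ := hχ
    obtain ⟨Q, hQ⟩ := hperm σ
    refine ⟨Q x, (hW _ _).mpr fun k => ?_, by simpa using hx0⟩
    rw [← hQ, (hW _ _).mp hx, map_smul, Function.comp_apply]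
  have hle : ⨆ χ, W χ ≤ LinearMap.eqLocus (f i) (f j) := by
    refine iSup_le fun χ x hx => ?_
    by_cases hχ : χ ∈ S
    · have hconst : χ i = χ j := by
        by_contra hij
        have := Fintype.card_le_card_of_perm_stable S hstable hχ hij
        omega
      rw [LinearMap.mem_eqLocus, (hW _ _).mp hx, (hW _ _).mp hx, hconst]
    · rw [hS, not_not] at hχ
      rw [hχ, Submodule.mem_bot] at hx
      rw [hx]
      exact zero_mem _
  rw [hsup, top_le_iff, LinearMap.eqLocus_eq_top] at hle
  exact hle

namespace LinearIsometry

variable {E : Type*} [NormedAddCommGroup E] [InnerProductSpace ℂ E]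

theorem norm_eq_one_of_apply_eq_smul (T : E →ₗᵢ[ℂ] E) {μ : ℂ} {x : E} (hx : T x = μ • x)
    (hx0 : x ≠ 0) : ‖μ‖ = 1 := by
  have h := T.norm_map x
  rw [hx, norm_smul] at h
  exact mul_right_cancel₀ (norm_ne_zero_iff.mpr hx0) (h.trans (one_mul _).symm)

theorem orthogonalFamily_eigenspaces (T : E →ₗᵢ[ℂ] E) :
    OrthogonalFamily ℂ (fun μ => eigenspace T.toLinearMap μ)
      fun μ => (eigenspace T.toLinearMap μ).subtypeₗᵢ := by
  rintro μ ν hμν ⟨x, hx⟩ ⟨y, hy⟩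
  have hx' : T x = μ • x := mem_eigenspace_iff.mp hx
  have hy' : T y = ν • y := mem_eigenspace_iff.mp hy
  change inner ℂ x y = 0
  by_contra hxy
  have hμ : ‖μ‖ = 1 := T.norm_eq_one_of_apply_eq_smul hx' (by rintro rfl; simp at hxy)
  have h := T.inner_map_map x y
  rw [hx', hy', inner_smul_left, inner_smul_right, ← mul_assoc] at h
  have h1 : (starRingEnd ℂ) μ * ν = 1 := mul_right_cancel₀ hxy (h.trans (one_mul _).symm)
  have h2 : (starRingEnd ℂ) μ * μ = 1 := by
    rw [Complex.conj_mul', hμ]; norm_num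
  exact hμν (mul_left_cancel₀ (left_ne_zero_of_mul_eq_one h2) (h2.trans h1.symm))

variable [FiniteDimensional ℂ E]

theorem orthogonal_mem_invtSubmodule (T : E →ₗᵢ[ℂ] E) {p : Submodule ℂ E}
    (hp : p ∈ invtSubmodule T.toLinearMap) : pᗮ ∈ invtSubmodule T.toLinearMap := by
  have hmap : p.map T.toLinearMap = p :=
    Submodule.eq_of_le_of_finrank_eq (Submodule.map_le_iff_le_comap.mpr hp)
      (LinearEquiv.finrank_eq (Submodule.equivMapOfInjective _ T.injective p)).symm
  intro x hx
  change T x ∈ pᗮ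
  rw [Submodule.mem_orthogonal]
  intro u hu
  rw [← hmap] at hu
  obtain ⟨v, hv, rfl⟩ := hu
  exact (T.inner_map_map v x).trans ((Submodule.mem_orthogonal _ _).mp hx v hv)

theorem isFinitelySemisimple (T : E →ₗᵢ[ℂ] E) : IsFinitelySemisimple T.toLinearMap := by
  refine isFinitelySemisimple_iff.mpr fun p hp _ q hq hqp =>
    ⟨qᗮ ⊓ p, inf_le_right, ?_, ?_, ?_⟩
  · exact invtSubmodule.inf_mem (T.orthogonal_mem_invtSubmodule hq) hp
  · exact (Submodule.orthogonal_disjoint q).mono_right inf_le_left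
  · rw [← sup_inf_assoc_of_le _ hqp, Submodule.sup_orthogonal_of_hasOrthogonalProjection,
      top_inf_eq]

theorem iSup_eigenspace_eq_top (T : E →ₗᵢ[ℂ] E) : ⨆ μ, eigenspace T.toLinearMap μ = ⊤ := by
  simp_rw [← T.isFinitelySemisimple.maxGenEigenspace_eq_eigenspace]
  exact iSup_maxGenEigenspace_eq_top _

/-- A linear isometry of a finite-dimensional complex inner product space has an orthonormal
basis of eigenvectors. -/
theorem exists_orthonormalBasis_eigenvectors (T : E →ₗᵢ[ℂ] E) {n : ℕ} (hn : finrank ℂ E = n) :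
    ∃ (b : OrthonormalBasis (Fin n) ℂ E) (μ : Fin n → ℂ), ∀ i, T (b i) = μ i • b i := by
  classical
  have horth := T.orthogonalFamily_eigenspaces.comp
    (Subtype.val_injective (p := fun μ => HasEigenvalue T.toLinearMap μ))
  have hint : DirectSum.IsInternal
      (fun μ : Eigenvalues T.toLinearMap => eigenspace T.toLinearMap μ) := by
    refine horth.isInternal_iff.mpr ?_
    rw [Submodule.orthogonal_eq_bot_iff]
    exact (iSup_ne_bot_subtype _).trans T.iSup_eigenspace_eq_top
  exact ⟨hint.subordinateOrthonormalBasis hn horth, _, fun i =>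
    mem_eigenspace_iff.mp (hint.subordinateOrthonormalBasis_subordinate hn i horth)⟩

end LinearIsometry

namespace Matrix.unitaryGroup

variable {ι : Type*} [Fintype ι] [DecidableEq ι]

/-- The diagonal unitary matrices, as the image of a torus. -/
def diagonalHom : (ι → Circle) →* unitaryGroup ι ℂ where
  toFun w := ⟨diagonal fun i => (w i : ℂ), mem_unitaryGroup_iff.mpr <| by
    rw [star_eq_conjTranspose, diagonal_conjTranspose, diagonal_mul_diagonal, ← diagonal_one]
    congr 1
    funext i
    simp [Complex.mul_conj]⟩
  map_one' := Subtype.ext <| by simp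
  map_mul' v w := Subtype.ext <| by simp

/-- The permutation matrices, as unitary matrices. -/
def ofPerm (σ : Equiv.Perm ι) : unitaryGroup ι ℂ :=
  ⟨σ.permMatrix ℂ, mem_unitaryGroup_iff.mpr <| by
    rw [star_eq_conjTranspose, conjTranspose_permMatrix, ← permMatrix_mul, inv_mul_cancel,
      permMatrix_one]⟩

theorem ofPerm_mul_diagonalHom (σ : Equiv.Perm ι) (w : ι → Circle) :
    ofPerm σ * diagonalHom w = diagonalHom (w ∘ σ) * ofPerm σ := by
  refine Subtype.ext ?_
  ext i j
  by_cases h : σ i = j <;>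
    simp [ofPerm, diagonalHom, Equiv.Perm.permMatrix, PEquiv.toMatrix_apply, h]

/-- Unitary diagonalization of a unitary matrix. -/
theorem exists_eq_conj_diagonalHom {n : ℕ} (U : unitaryGroup (Fin n) ℂ) :
    ∃ (V : unitaryGroup (Fin n) ℂ) (w : Fin n → Circle), U = V * diagonalHom w * V⁻¹ := by
  have hmem : toEuclideanCLM (n := Fin n) (𝕜 := ℂ) U.1 ∈
      unitary (EuclideanSpace ℂ (Fin n) →L[ℂ] EuclideanSpace ℂ (Fin n)) :=
    Unitary.map_mem (toEuclideanCLM (n := Fin n) (𝕜 := ℂ)) U.2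
  let T : EuclideanSpace ℂ (Fin n) →ₗᵢ[ℂ] EuclideanSpace ℂ (Fin n) :=
    (Unitary.linearIsometryEquiv ⟨_, hmem⟩).toLinearIsometry
  obtain ⟨b, μ, hb⟩ := T.exists_orthonormalBasis_eigenvectors finrank_euclideanSpace_fin
  have hμ : ∀ i, ‖μ i‖ = 1 := fun i =>
    T.norm_eq_one_of_apply_eq_smul (hb i) (b.orthonormal.ne_zero i)
  let V : unitaryGroup (Fin n) ℂ := ⟨(EuclideanSpace.basisFun (Fin n) ℂ).toBasis.toMatrix b.toBasis,
    (EuclideanSpace.basisFun (Fin n) ℂ).toMatrix_orthonormalBasis_mem_unitary b⟩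
  refine ⟨V, fun i => ⟨μ i, mem_sphere_zero_iff_norm.mpr (hμ i)⟩, ?_⟩
  rw [eq_mul_inv_iff_mul_eq]
  refine Subtype.ext ?_
  ext i j
  have h := congrArg (fun x : EuclideanSpace ℂ (Fin n) => x i) (hb j)
  simp only [PiLp.smul_apply, smul_eq_mul] at h
  change (U.1 * V.1) i j = (V.1 * diagonal μ) i j
  rw [mul_diagonal, mul_comm]
  exact h

end Matrix.unitaryGroup

open Matrix.unitaryGroup in
/-- Let `n ≥ 2`, let `H` be a complex Hilbert space of dimension strictly less than `n`,
and let `ρ` be a strongly continuous unitary representation of `U(n)` on `H`. Then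
`ρ(U) = 1` for every `U ∈ SU(n)`. -/
theorem representation_dim_lt_trivial_on_SU
    (n : ℕ) (hn : 2 ≤ n)
    (H : Type*) [NormedAddCommGroup H] [InnerProductSpace ℂ H] [CompleteSpace H]
    (hdim : Module.rank ℂ H < (n : Cardinal))
    (ρ : Matrix.unitaryGroup (Fin n) ℂ →* unitary (H →L[ℂ] H))
    (hρ_cont : ∀ v : H,
      Continuous fun U : Matrix.unitaryGroup (Fin n) ℂ => (ρ U : H →L[ℂ] H) v) :
    ∀ U : Matrix.unitaryGroup (Fin n) ℂ,
      Matrix.det (U : Matrix (Fin n) (Fin n) ℂ) = 1 → (ρ U : H →L[ℂ] H) = 1 := by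
  intro U hU
  have hfin : FiniteDimensional ℂ H :=
    Module.rank_lt_aleph0_iff.mp (hdim.trans (Cardinal.natCast_lt_aleph0))
  have hrank : finrank ℂ H < Fintype.card (Fin n) := by
    rw [← finrank_eq_rank, Nat.cast_lt] at hdim
    rwa [Fintype.card_fin]
  have hmul : ∀ (A B : Matrix.unitaryGroup (Fin n) ℂ) (x : H),
      (ρ (A * B) : H →L[ℂ] H) x = (ρ A : H →L[ℂ] H) ((ρ B : H →L[ℂ] H) x) := fun A B x => by
    rw [map_mul]; rfl
  let T : Matrix.unitaryGroup (Fin n) ℂ → H ≃ₗᵢ[ℂ] H := fun A => Unitary.linearIsometryEquiv (ρ A)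
  have hsingle : ∀ (z : Circle) (i j : Fin n),
      ρ (diagonalHom (Pi.mulSingle i z)) = ρ (diagonalHom (Pi.mulSingle j z)) := by
    intro z i j
    let f : Fin n → Module.End ℂ H := fun k =>
      (T (diagonalHom (Pi.mulSingle k z))).toLinearIsometry.toLinearMap
    have hf : ∀ k x, f k x = (ρ (diagonalHom (Pi.mulSingle k z)) : H →L[ℂ] H) x :=
      fun k x => rfl
    have key : f i = f j := by
      refine eq_of_commute_of_forall_perm_conj f (fun k l => LinearMap.ext fun x => ?_)
        (fun k => (T (diagonalHom (Pi.mulSingle k z))).toLinearIsometry.isFinitelySemisimple) (fun k => iSup_maxGenEigenspace_eq_top _)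
        (fun σ => ⟨(T (ofPerm σ)).toLinearEquiv, fun k x => ?_⟩) hrank i j
      · simp only [Module.End.mul_apply, hf]
        rw [← hmul, ← hmul, ← map_mul, ← map_mul, mul_comm]
      · change (ρ (ofPerm σ) : H →L[ℂ] H) (f (σ k) x) = f k ((ρ (ofPerm σ) : H →L[ℂ] H) x)
        rw [hf, hf, ← hmul, ← hmul, ofPerm_mul_diagonalHom]
        have : (Pi.mulSingle (σ k) z : Fin n → Circle) ∘ σ = Pi.mulSingle k z := by
          funext l
          simp [Pi.mulSingle_apply]
        rw [this]
    exact Subtype.ext (ContinuousLinearMap.ext fun x => LinearMap.congr_fun key x)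
  obtain ⟨V, w, rfl⟩ := exists_eq_conj_diagonalHom U
  have hw : ∏ i, w i = 1 := by
    rw [Matrix.UnitaryGroup.mul_val, Matrix.UnitaryGroup.mul_val, Matrix.UnitaryGroup.inv_val,
      Matrix.det_mul_right_comm, Unitary.mul_star_self_of_mem V.2,
      one_mul] at hU
    exact Circle.ext ((map_prod Circle.coeHom w Finset.univ).trans
      (Matrix.det_diagonal.symm.trans hU))
  let o : Fin n := ⟨0, by omega⟩
  have hprod : ∀ s : Finset (Fin n), ρ (diagonalHom (∏ i ∈ s, Pi.mulSingle i (w i))) =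
      ρ (diagonalHom (Pi.mulSingle o (∏ i ∈ s, w i))) := by
    intro s
    induction s using Finset.induction_on with
    | empty => simp
    | insert i s his ih =>
      rw [Finset.prod_insert his, Finset.prod_insert his, Pi.mulSingle_mul, map_mul, map_mul,
        map_mul, map_mul, ih, hsingle (w i) i o]
  have hdiag : ρ (diagonalHom w) = 1 := by
    rw [← Finset.univ_prod_mulSingle w, hprod, hw, Pi.mulSingle_one, map_one, map_one]
  rw [map_mul, map_mul, hdiag, mul_one, ← map_mul, mul_inv_cancel, map_one]
  rfl
end

section
/- Assume d ≥ 2 and let A_1, A_2 be P-modules in ℝ^d such that A_2 is not a translate of A_1, i.e. A_1 + z ≠ A_2 for every z ∈ ℝ^d. For i ∈ {1,2} and z ∈ ℝ^d, let W^{(i)}_z be the partial isometry on L²(A_i) defined by (W^{(i)}_z f)(y) = f(y − z) if y − z ∈ A_i and 0 otherwise. If T : L²(A_2) → L²(A_1) is a bounded operator satisfying T W^{(2)}_z = W^{(1)}_z T for every z ∈ ℝ^d, then T = 0. -/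
open MeasureTheory Set Topology

/-- A convex set containing `0` whose differences exhaust the space has nonempty interior. -/
theorem interior_nonempty_of_convex_of_sub_eq_univ {E : Type*} [NormedAddCommGroup E]
    [NormedSpace ℝ E] [FiniteDimensional ℝ E] {P : Set E} (hconv : Convex ℝ P)
    (hzero : (0 : E) ∈ P) (hspan : ∀ v : E, ∃ x ∈ P, ∃ y ∈ P, v = x - y) :
    (interior P).Nonempty := by
  rw [hconv.interior_nonempty_iff_affineSpan_eq_top,
    AffineSubspace.affineSpan_eq_top_iff_vectorSpan_eq_top_of_nonempty ℝ E E ⟨0, hzero⟩, eq_top_iff]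
  intro v _
  obtain ⟨x, hx, y, hy, rfl⟩ := hspan v
  exact vsub_mem_vectorSpan ℝ hx hy

/-- A set absorbing translations by a cone with nonempty interior lies in the closure of its
interior. -/
theorem subset_closure_interior_of_add_cone {E : Type*} [NormedAddCommGroup E]
    [NormedSpace ℝ E] {P A : Set E} (hcone : ∀ x ∈ P, ∀ t : ℝ, 0 ≤ t → t • x ∈ P)
    (hint : (interior P).Nonempty) (hmod : ∀ b ∈ A, ∀ p ∈ P, b + p ∈ A) :
    A ⊆ closure (interior A) := by
  obtain ⟨p, hp⟩ := hint
  intro b hb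
  have hlim : Filter.Tendsto (fun t : ℝ => b + t • p) (𝓝[>] 0) (𝓝 b) := by
    have hcont : Continuous fun t : ℝ => b + t • p := by fun_prop
    simpa using (hcont.tendsto 0).mono_left nhdsWithin_le_nhds
  refine mem_closure_of_tendsto hlim ?_
  filter_upwards [self_mem_nhdsWithin] with t (ht : 0 < t)
  have hopen : IsOpen ((fun y : E => t⁻¹ • (y - b)) ⁻¹' interior P) :=
    isOpen_interior.preimage (by fun_prop)
  refine interior_maximal ?_ hopen ?_
  · intro y hy
    have hmem := hmod b hb _ (hcone _ (interior_subset hy) t ht.le)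
    simpa [smul_smul, ht.ne'] using hmem
  · simpa [smul_smul, ht.ne'] using hp

/-- If a translate of the interior of `A` lies in the closed set `B`, so does the translate
of `A`. -/
theorem add_mem_of_interior_add_mem {E : Type*} [NormedAddCommGroup E] {A B : Set E} {c : E}
    (hA : A ⊆ closure (interior A)) (hB : IsClosed B)
    (h : ∀ w ∈ interior A, w + c ∈ B) : ∀ w ∈ A, w + c ∈ B := fun _ hw =>
  closure_minimal (s := interior A) (t := (fun w => w + c) ⁻¹' B) h
    (hB.preimage (by fun_prop)) (hA hw)

/-- Two closed sets, each the closure of its interior, which are not translates of each other,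
can be told apart at any pair of base points by an open condition. -/
theorem exists_separating_translation {E : Type*} [NormedAddCommGroup E] {A B : Set E}
    (hA : IsClosed A) (hB : IsClosed B) (hA' : A ⊆ closure (interior A))
    (hB' : B ⊆ closure (interior B)) (hnt : ∀ z : E, (fun b => b + z) '' A ≠ B) (x y : E) :
    ∃ z, (x - z ∈ interior A ∧ y - z ∉ B) ∨ (x - z ∉ A ∧ y - z ∈ interior B) := by
  by_contra! hcon
  refine hnt (y - x) (Subset.antisymm ?_ ?_)
  · rintro _ ⟨w, hw, rfl⟩
    refine add_mem_of_interior_add_mem hA' hB (fun u hu => ?_) w hw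
    have := (hcon (x - u)).1 (by simpa using hu)
    rwa [show u + (y - x) = y - (x - u) by abel]
  · intro w hw
    refine ⟨w + (x - y), ?_, by dsimp only; abel⟩
    refine add_mem_of_interior_add_mem hB' hA (fun u hu => ?_) w hw
    by_contra hu'
    refine (hcon (y - u)).2 ?_ (by simpa using hu)
    rwa [show x - (y - u) = u + (x - y) by abel]

/-- The range projection `W_z W_{-z}` is multiplication by the indicator of `A + z`. -/
theorem coeFn_translation_comp_neg {E : Type*} [NormedAddCommGroup E]
    [MeasurableSpace E] [BorelSpace E] {μ : Measure E}
    [μ.IsAddRightInvariant] {A : Set E} (hA : MeasurableSet A)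
    {W : E → (Lp ℂ 2 (μ.restrict A) →L[ℂ] Lp ℂ 2 (μ.restrict A))}
    (hW : ∀ z : E, ∀ f : Lp ℂ 2 (μ.restrict A),
      ⇑(W z f) =ᵐ[μ.restrict A] fun y => A.indicator (⇑f) (y - z))
    (z : E) (f : Lp ℂ 2 (μ.restrict A)) :
    ⇑(W z (W (-z) f)) =ᵐ[μ.restrict A] fun y => ((fun w => w - z) ⁻¹' A).indicator (⇑f) y := by
  have hinner := hW (-z) f
  have houter := hW z (W (-z) f)
  rw [Filter.EventuallyEq, ae_restrict_iff' hA] at *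
  have hshift := (measurePreserving_sub_right μ z).quasiMeasurePreserving.ae hinner
  filter_upwards [houter, hshift] with y hy hs hyA
  rw [hy hyA]
  by_cases hyz : y - z ∈ A
  · simp [indicator, hyz, hs hyz, hyA]
  · simp [indicator, hyz]

/-- A property `S s t`, antitone in both sets and stable under finite unions in each of them, which
holds locally near each point of the product, holds for any two compact sets. -/
theorem rel_of_isCompact_of_local {X Y : Type*} [TopologicalSpace X] [TopologicalSpace Y]
    {S : Set X → Set Y → Prop} (hmono : ∀ ⦃s s' t t'⦄, s ⊆ s' → t ⊆ t' → S s' t' → S s t)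
    (hempty : ∀ t, S ∅ t) (hempty' : ∀ s, S s ∅)
    (hunion : ∀ ⦃s s' t⦄, S s t → S s' t → S (s ∪ s') t)
    (hunion' : ∀ ⦃s t t'⦄, IsOpen t → IsOpen t' → S s t → S s t' → S s (t ∪ t'))
    (hlocal : ∀ x y, ∃ U V, IsOpen U ∧ x ∈ U ∧ IsOpen V ∧ y ∈ V ∧ S U V)
    {K : Set X} {L : Set Y} (hK : IsCompact K) (hL : IsCompact L) : S K L := by
  have hKy : ∀ y, ∃ V, IsOpen V ∧ y ∈ V ∧ S K V := by
    intro y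
    refine hK.induction_on (p := fun s => ∃ V, IsOpen V ∧ y ∈ V ∧ S s V)
      ⟨univ, isOpen_univ, mem_univ y, hempty _⟩ ?_ ?_ ?_
    · rintro s t hst ⟨V, hV, hyV, h⟩
      exact ⟨V, hV, hyV, hmono hst subset_rfl h⟩
    · rintro s t ⟨V, hV, hyV, h⟩ ⟨V', hV', hyV', h'⟩
      exact ⟨V ∩ V', hV.inter hV', ⟨hyV, hyV'⟩,
        hunion (hmono subset_rfl inter_subset_left h) (hmono subset_rfl inter_subset_right h')⟩
    · intro x _
      obtain ⟨U, V, hU, hxU, hV, hyV, h⟩ := hlocal x y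
      exact ⟨U, mem_nhdsWithin_of_mem_nhds (hU.mem_nhds hxU), V, hV, hyV, h⟩
  have hKL : ∃ V, IsOpen V ∧ L ⊆ V ∧ S K V := by
    refine hL.induction_on (p := fun t => ∃ V, IsOpen V ∧ t ⊆ V ∧ S K V)
      ⟨∅, isOpen_empty, subset_rfl, hempty' _⟩ ?_ ?_ ?_
    · rintro s t hst ⟨V, hV, htV, h⟩
      exact ⟨V, hV, hst.trans htV, h⟩
    · rintro s t ⟨V, hV, hsV, h⟩ ⟨V', hV', htV', h'⟩
      exact ⟨V ∪ V', hV.union hV', union_subset_union hsV htV', hunion' hV hV' h h'⟩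
    · intro y _
      obtain ⟨V, hV, hyV, h⟩ := hKy y
      exact ⟨V, mem_nhdsWithin_of_mem_nhds (hV.mem_nhds hyV), V, hV, subset_rfl, h⟩
  obtain ⟨V, -, hLV, h⟩ := hKL
  exact hmono subset_rfl hLV h

/-- The block of `T` from functions supported in `t` to functions restricted to `s` vanishes. -/
def BlockVanishes {X Y : Type*} [MeasurableSpace X] [MeasurableSpace Y] {μ : Measure X}
    {ν : Measure Y} (T : Lp ℂ 2 ν →L[ℂ] Lp ℂ 2 μ) (s : Set X) (t : Set Y) : Prop :=
  ∀ f : Lp ℂ 2 ν, (∀ᵐ y ∂ν, y ∉ t → f y = 0) → ∀ᵐ x ∂μ, x ∈ s → T f x = 0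

/-- Vanishing blocks can be glued along a union of domains, one of them measurable. -/
theorem BlockVanishes.union_right {X Y : Type*} [MeasurableSpace X] [MeasurableSpace Y]
    {μ : Measure X} {ν : Measure Y} {T : Lp ℂ 2 ν →L[ℂ] Lp ℂ 2 μ} {s : Set X} {t t' : Set Y}
    (ht : MeasurableSet t) (h : BlockVanishes T s t) (h' : BlockVanishes T s t') :
    BlockVanishes T s (t ∪ t') := by
  intro f hf
  have hmem : MemLp (t.indicator f) 2 ν := (Lp.memLp f).indicator ht
  set g : Lp ℂ 2 ν := hmem.toLp _
  have hgf : ⇑g =ᵐ[ν] t.indicator f := hmem.coeFn_toLp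
  have hTg := h g (by
    filter_upwards [hgf] with y hy hyt
    rw [hy, indicator_of_notMem hyt])
  have hTfg := h' (f - g) (by
    filter_upwards [hgf, Lp.coeFn_sub f g, hf] with y hy hsub hfy hyt
    rw [hsub, Pi.sub_apply, hy]
    by_cases hyt' : y ∈ t
    · simp [hyt']
    · simp [hyt', hfy (by simp [hyt, hyt'])])
  have hsplit : T f = T g + T (f - g) := by rw [← map_add]; congr 1; abel
  filter_upwards [hTg, hTfg, Lp.coeFn_add (T g) (T (f - g))] with x hx hx' hadd hxs
  rw [hsplit, hadd, Pi.add_apply, hx hxs, hx' hxs, add_zero]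

/-- An operator whose blocks between compact sets vanish is zero. -/
theorem eq_zero_of_blockVanishes_isCompact {X Y : Type*}
    [TopologicalSpace X] [SigmaCompactSpace X] [MeasurableSpace X]
    [TopologicalSpace Y] [NormalSpace Y] [R1Space Y] [WeaklyLocallyCompactSpace Y]
    [MeasurableSpace Y] [BorelSpace Y] {μ : Measure X} {ν : Measure Y} [ν.Regular]
    {T : Lp ℂ 2 ν →L[ℂ] Lp ℂ 2 μ}
    (h : ∀ K L, IsCompact K → IsCompact L → BlockVanishes T K L) : T = 0 := by
  have hcompact : ∀ (f : Lp ℂ 2 ν) (L : Set Y), IsCompact L → (∀ᵐ y ∂ν, y ∉ L → f y = 0) →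
      T f = 0 := by
    intro f L hL hf
    rw [Lp.eq_zero_iff_ae_eq_zero]
    have hall := ae_all_iff.2 fun n => h (compactCovering X n) L (isCompact_compactCovering X n) hL
      f hf
    filter_upwards [hall] with x hx
    obtain ⟨n, hn⟩ := mem_iUnion.1 ((iUnion_compactCovering X).symm ▸ mem_univ x)
    exact hx n hn
  ext1 f
  have hclosed : IsClosed {f | T f = 0} := isClosed_singleton.preimage T.continuous
  suffices hmem : f ∈ closure {f | T f = 0} by simpa using hclosed.closure_subset hmem
  rw [EMetric.mem_closure_iff]
  intro ε hε
  obtain ⟨δ, hδ, hδε⟩ := exists_between hε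
  obtain ⟨g, hgsupp, hfg, -, hg⟩ :=
    (Lp.memLp f).exists_hasCompactSupport_eLpNorm_sub_le (by norm_num) hδ.ne'
  refine ⟨hg.toLp g, hcompact _ _ hgsupp ?_, ?_⟩
  · filter_upwards [hg.coeFn_toLp] with y hy hyg
    rw [hy, image_eq_zero_of_notMem_tsupport hyg]
  · refine lt_of_le_of_lt ?_ hδε
    rw [Lp.edist_def]
    refine le_of_eq_of_le (eLpNorm_congr_ae ?_) hfg
    filter_upwards [hg.coeFn_toLp] with y hy
    simp [hy]

/-- For `d ≥ 2`, let `A₁, A₂` be `P`-modules with `A₂` not a translate of `A₁`, and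
for `i = 1, 2` let `W^{(i)}_z` be the partial isometries on `L²(Aᵢ)` given by
`(W_z f)(y) = f (y - z)` if `y - z ∈ Aᵢ` and `0` otherwise. Then any bounded operator
`T : L²(A₂) → L²(A₁)` intertwining the two families (`T W^{(2)}_z = W^{(1)}_z T` for
all `z`) is zero. -/
theorem intertwiner_of_nontranslate_modules_eq_zero
    (d : ℕ) (hd : 2 ≤ d) (P A₁ A₂ : Set (EuclideanSpace ℝ (Fin d)))
    (hPclosed : IsClosed P) (hPconvex : Convex ℝ P)
    (hPcone : ∀ x ∈ P, ∀ t : ℝ, 0 ≤ t → t • x ∈ P)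
    (hPspan : ∀ v : EuclideanSpace ℝ (Fin d), ∃ x ∈ P, ∃ y ∈ P, v = x - y)
    (hPpointed : P ∩ (-P) = {0})
    (hA₁closed : IsClosed A₁) (hA₁proper : A₁ ≠ Set.univ)
    (hA₁zero : (0 : EuclideanSpace ℝ (Fin d)) ∈ A₁)
    (hA₁mod : ∀ b ∈ A₁, ∀ p ∈ P, b + p ∈ A₁)
    (hA₂closed : IsClosed A₂) (hA₂proper : A₂ ≠ Set.univ)
    (hA₂zero : (0 : EuclideanSpace ℝ (Fin d)) ∈ A₂)
    (hA₂mod : ∀ b ∈ A₂, ∀ p ∈ P, b + p ∈ A₂)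
    (hnt : ∀ z : EuclideanSpace ℝ (Fin d), (fun b => b + z) '' A₁ ≠ A₂)
    (W₁ : EuclideanSpace ℝ (Fin d) →
      (Lp ℂ 2 (volume.restrict A₁) →L[ℂ] Lp ℂ 2 (volume.restrict A₁)))
    (hW₁ : ∀ z : EuclideanSpace ℝ (Fin d), ∀ f : Lp ℂ 2 (volume.restrict A₁),
      ⇑(W₁ z f) =ᵐ[volume.restrict A₁] fun y => A₁.indicator (⇑f) (y - z))
    (W₂ : EuclideanSpace ℝ (Fin d) →
      (Lp ℂ 2 (volume.restrict A₂) →L[ℂ] Lp ℂ 2 (volume.restrict A₂)))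
    (hW₂ : ∀ z : EuclideanSpace ℝ (Fin d), ∀ f : Lp ℂ 2 (volume.restrict A₂),
      ⇑(W₂ z f) =ᵐ[volume.restrict A₂] fun y => A₂.indicator (⇑f) (y - z))
    (T : Lp ℂ 2 (volume.restrict A₂) →L[ℂ] Lp ℂ 2 (volume.restrict A₁))
    (hT : ∀ z : EuclideanSpace ℝ (Fin d), T.comp (W₂ z) = (W₁ z).comp T) :
    T = 0 := by
  have hPzero : (0 : EuclideanSpace ℝ (Fin d)) ∈ P :=
    (hPpointed.symm ▸ mem_singleton _ : (0 : EuclideanSpace ℝ (Fin d)) ∈ P ∩ (-P)).1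
  have hPint := interior_nonempty_of_convex_of_sub_eq_univ hPconvex hPzero hPspan
  have hsep := exists_separating_translation hA₁closed hA₂closed
    (subset_closure_interior_of_add_cone hPcone hPint hA₁mod)
    (subset_closure_interior_of_add_cone hPcone hPint hA₂mod) hnt
  refine eq_zero_of_blockVanishes_isCompact fun K L hK hL =>
    rel_of_isCompact_of_local (S := BlockVanishes T) ?_ ?_ ?_ ?_ ?_ ?_ hK hL
  · intro s s' t t' hs ht h f hf
    filter_upwards [h f (hf.mono fun y hy hyt => hy (notMem_subset ht hyt))] with x hx hxs
    exact hx (hs hxs)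
  · intro t f _
    simp
  · intro s f hf
    have hf0 : f = 0 := by
      rw [Lp.eq_zero_iff_ae_eq_zero]
      filter_upwards [hf] with y hy using hy (notMem_empty y)
    rw [hf0, map_zero]
    filter_upwards [Lp.coeFn_zero ℂ 2 (volume.restrict A₁)] with x hx _ using hx
  · intro s s' t h h' f hf
    filter_upwards [h f hf, h' f hf] with x hx hx' hxs using hxs.elim hx hx'
  · intro s t t' ht _ h h'
    exact h.union_right ht.measurableSet h'
  · intro x y
    obtain ⟨z, hz⟩ := hsep x y
    have hcont : Continuous fun w : EuclideanSpace ℝ (Fin d) => w - z := by fun_prop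
    have hcomm : ∀ f, T (W₂ z (W₂ (-z) f)) = W₁ z (W₁ (-z) (T f)) := fun f => by
      have h₁ := DFunLike.congr_fun (hT z) (W₂ (-z) f)
      have h₂ := DFunLike.congr_fun (hT (-z)) f
      simp only [ContinuousLinearMap.comp_apply] at h₁ h₂
      rw [h₁, h₂]
    have hproj₁ := coeFn_translation_comp_neg hA₁closed.measurableSet hW₁ z
    have hproj₂ := coeFn_translation_comp_neg hA₂closed.measurableSet hW₂ z
    rcases hz with ⟨hx, hy⟩ | ⟨hx, hy⟩
    · refine ⟨(fun w => w - z) ⁻¹' interior A₁, (fun w => w - z) ⁻¹' A₂ᶜ,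
        isOpen_interior.preimage hcont, hx, hA₂closed.isOpen_compl.preimage hcont, hy, ?_⟩
      intro f hf
      have hzero : W₂ z (W₂ (-z) f) = 0 := by
        rw [Lp.eq_zero_iff_ae_eq_zero]
        filter_upwards [hproj₂ f, hf] with w hw hfw
        by_cases hwz : w - z ∈ A₂
        · simp [hw, indicator, hwz, hfw (by simpa using hwz)]
        · simp [hw, indicator, hwz]
      have hTzero := hcomm f
      rw [hzero, map_zero] at hTzero
      have hproj := hproj₁ (T f)
      rw [← hTzero] at hproj
      filter_upwards [hproj, Lp.coeFn_zero ℂ 2 (volume.restrict A₁)] with w hw hw0 hwz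
      rw [hw0, indicator_of_mem (preimage_mono interior_subset hwz)] at hw
      simpa using hw.symm
    · refine ⟨(fun w => w - z) ⁻¹' A₁ᶜ, (fun w => w - z) ⁻¹' interior A₂,
        hA₁closed.isOpen_compl.preimage hcont, hx, isOpen_interior.preimage hcont, hy, ?_⟩
      intro f hf
      have hfix : W₂ z (W₂ (-z) f) = f := by
        refine Lp.ext ?_
        filter_upwards [hproj₂ f, hf] with w hw hfw
        by_cases hwz : w - z ∈ A₂
        · simp [hw, indicator, hwz]
        · simp [hw, indicator, hwz, hfw fun hi => hwz (interior_subset hi)]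
      have hproj := hproj₁ (T f)
      rw [← hcomm f, hfix] at hproj
      filter_upwards [hproj] with w hw hwz
      rw [hw, indicator_of_notMem (show w ∉ (fun w => w - z) ⁻¹' A₁ from hwz)]
end

section
/- Let Y be a second countable locally compact Hausdorff space with a continuous action of ℝ^d, written (y, t) ↦ y + t, and let y_1, y_2 ∈ Y. For y ∈ Y and a bounded Borel function f : Y → ℂ, let M_y(f) be the bounded operator on L²(ℝ^d) defined by (M_y(f)ξ)(t) = f(y + t)ξ(t), and for s ∈ ℝ^d let L_s be the unitary on L²(ℝ^d) defined by (L_s ξ)(t) = ξ(t + s). Then there exists a nonzero bounded operator T on L²(ℝ^d) satisfying T L_s = L_s T for every s ∈ ℝ^d and T M_{y_1}(f) = M_{y_2}(f) T for every bounded Borel function f on Y, if and only if there exists s ∈ ℝ^d with y_1 + s = y_2. -/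
open MeasureTheory

/-- The range of a continuous map from a σ-compact space to a Hausdorff space is Borel. -/
theorem measurableSet_range_of_continuous_of_sigmaCompact {X Y : Type*} [TopologicalSpace X]
    [SigmaCompactSpace X] [TopologicalSpace Y] [T2Space Y] [MeasurableSpace Y] [BorelSpace Y]
    {g : X → Y} (hg : Continuous g) : MeasurableSet (Set.range g) := by
  rw [← Set.image_univ, ← iUnion_compactCovering, Set.image_iUnion]
  exact MeasurableSet.iUnion fun n =>
    ((isCompact_compactCovering X n).image hg).isClosed.measurableSet

/-- Let `Y` be a second countable locally compact Hausdorff space with a continuous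
action of `ℝ^d`, and let `y₁, y₂ ∈ Y`. Let `L_s` be the translation unitaries on
`L²(ℝ^d)`, `(L_s ξ)(t) = ξ (t + s)`, and for `y ∈ Y` and a bounded Borel function
`f : Y → ℂ` let `M_y(f)` be the multiplication operator `(M_y(f) ξ)(t) = f (y + t) ξ t`.
Then there exists a nonzero bounded operator `T` on `L²(ℝ^d)` with `T L_s = L_s T` for
all `s` and `T M_{y₁}(f) = M_{y₂}(f) T` for all bounded Borel `f`, if and only if
`y₁ + s = y₂` for some `s ∈ ℝ^d`. -/
theorem induced_representations_nondisjoint_iff_same_orbit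
    (d : ℕ) (Y : Type*) [TopologicalSpace Y] [SecondCountableTopology Y]
    [LocallyCompactSpace Y] [T2Space Y] [MeasurableSpace Y] [BorelSpace Y]
    (act : Y → EuclideanSpace ℝ (Fin d) → Y)
    (hact_cont : Continuous fun p : Y × EuclideanSpace ℝ (Fin d) => act p.1 p.2)
    (hact_zero : ∀ y : Y, act y 0 = y)
    (hact_add : ∀ (y : Y) (s t : EuclideanSpace ℝ (Fin d)), act (act y s) t = act y (s + t))
    (y₁ y₂ : Y)
    (L : EuclideanSpace ℝ (Fin d) →
      (Lp ℂ 2 (volume : Measure (EuclideanSpace ℝ (Fin d))) →L[ℂ]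
        Lp ℂ 2 (volume : Measure (EuclideanSpace ℝ (Fin d)))))
    (hL : ∀ s : EuclideanSpace ℝ (Fin d),
      ∀ ξ : Lp ℂ 2 (volume : Measure (EuclideanSpace ℝ (Fin d))),
        ⇑(L s ξ) =ᵐ[volume] fun t => ξ (t + s))
    (M : Y → (Y → ℂ) →
      (Lp ℂ 2 (volume : Measure (EuclideanSpace ℝ (Fin d))) →L[ℂ]
        Lp ℂ 2 (volume : Measure (EuclideanSpace ℝ (Fin d)))))
    (hM : ∀ y : Y, ∀ f : Y → ℂ, Measurable f → (∃ C : ℝ, ∀ v : Y, ‖f v‖ ≤ C) →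
      ∀ ξ : Lp ℂ 2 (volume : Measure (EuclideanSpace ℝ (Fin d))),
        ⇑(M y f ξ) =ᵐ[volume] fun t => f (act y t) * ξ t) :
    (∃ T : Lp ℂ 2 (volume : Measure (EuclideanSpace ℝ (Fin d))) →L[ℂ]
        Lp ℂ 2 (volume : Measure (EuclideanSpace ℝ (Fin d))),
      T ≠ 0 ∧
      (∀ s : EuclideanSpace ℝ (Fin d), T.comp (L s) = (L s).comp T) ∧
      (∀ f : Y → ℂ, Measurable f → (∃ C : ℝ, ∀ v : Y, ‖f v‖ ≤ C) →
        T.comp (M y₁ f) = (M y₂ f).comp T)) ↔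
    (∃ s : EuclideanSpace ℝ (Fin d), act y₁ s = y₂) := by
  constructor
  · rintro ⟨T, hT, -, hTM⟩
    by_contra hne
    have hf : Measurable ((Set.range (act y₁)).indicator (fun _ => (1 : ℂ))) :=
      measurable_const.indicator (measurableSet_range_of_continuous_of_sigmaCompact (by fun_prop))
    have hb : ∃ C : ℝ, ∀ v : Y, ‖(Set.range (act y₁)).indicator (fun _ => (1 : ℂ)) v‖ ≤ C :=
      ⟨1, fun v => (norm_indicator_le_norm_self _ _).trans (by simp)⟩
    refine hT (ContinuousLinearMap.ext fun ξ => ?_)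
    have h₁ : M y₁ ((Set.range (act y₁)).indicator fun _ => 1) ξ = ξ := by
      refine Lp.ext ((hM y₁ _ hf hb ξ).trans (.of_forall fun t => ?_))
      simp
    have h₂ : M y₂ ((Set.range (act y₁)).indicator fun _ => 1) (T ξ) = 0 := by
      refine Lp.ext (((hM y₂ _ hf hb (T ξ)).trans (.of_forall fun t => ?_)).trans
        (Lp.coeFn_zero _ _ _).symm)
      have ht : act y₂ t ∉ Set.range (act y₁) := by
        rintro ⟨s, hs⟩
        refine hne ⟨s + -t, ?_⟩
        rw [← hact_add, hs, hact_add, add_neg_cancel, hact_zero]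
      simp only [Set.indicator_of_notMem ht, zero_mul, Pi.zero_apply]
    have h := DFunLike.congr_fun (hTM _ hf hb) ξ
    rw [ContinuousLinearMap.comp_apply, ContinuousLinearMap.comp_apply, h₁, h₂] at h
    exact h
  · rintro ⟨s, rfl⟩
    have hshift : ∀ (r : EuclideanSpace ℝ (Fin d)) {u v : EuclideanSpace ℝ (Fin d) → ℂ},
        u =ᵐ[volume] v → (fun t => u (t + r)) =ᵐ[volume] fun t => v (t + r) := fun r _ _ h =>
      (measurePreserving_add_right volume r).quasiMeasurePreserving.ae_eq_comp h
    have hLL : ∀ (r r' : EuclideanSpace ℝ (Fin d))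
        (ξ : Lp ℂ 2 (volume : Measure (EuclideanSpace ℝ (Fin d)))),
        ⇑(L r (L r' ξ)) =ᵐ[volume] fun t => ξ (t + r + r') := fun r r' ξ =>
      (hL r (L r' ξ)).trans (hshift r (hL r' ξ))
    refine ⟨L s, fun h0 => ?_, fun r => ?_, fun f hf hb => ?_⟩
    · have hball : volume (Metric.ball (0 : EuclideanSpace ℝ (Fin d)) 1) ≠ ⊤ :=
        measure_ball_lt_top.ne
      have hξ : indicatorConstLp 2 Metric.isOpen_ball.measurableSet hball (1 : ℂ) = 0 := by
        refine Lp.ext ?_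
        have h := hLL (-s) s (indicatorConstLp 2 Metric.isOpen_ball.measurableSet hball (1 : ℂ))
        rw [h0, zero_apply, map_zero] at h
        simpa only [neg_add_cancel_right] using h.symm
      have hn := congrArg norm hξ
      rw [norm_indicatorConstLp (by norm_num) (by norm_num), norm_zero, norm_one, one_mul] at hn
      have hpos : 0 < volume.real (Metric.ball (0 : EuclideanSpace ℝ (Fin d)) 1) :=
        ENNReal.toReal_pos (Metric.measure_ball_pos _ _ one_pos).ne' hball
      exact (Real.rpow_pos_of_pos hpos _).ne' hn
    · refine ContinuousLinearMap.ext fun ξ => Lp.ext ?_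
      refine (hLL s r ξ).trans (.trans (.of_forall fun t => ?_) (hLL r s ξ).symm)
      simp only [add_right_comm]
    · refine ContinuousLinearMap.ext fun ξ => Lp.ext ?_
      refine ((hL s (M y₁ f ξ)).trans (hshift s (hM y₁ f hf hb ξ))).trans ?_
      refine .trans ?_ (hM (act y₁ s) f hf hb (L s ξ)).symm
      filter_upwards [hL s ξ] with t ht
      rw [ht, hact_add, add_comm s t]
end
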